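/- Soundness of the encoding: for a functional EPTS, (1) if Γ is well-formed in the EPTS, then ⟦Γ⟧ is well-formed in the Dedukti theory (Σ_EPTS, 𝓡_EPTS); (2) if Γ ⊢ M : A in the EPTS, then: if A is a top-sort, ⟦Γ⟧ ⊢ ⟦M⟧ : U_A in Dedukti; otherwise ⟦Γ⟧ ⊢ ⟦M⟧ : El_{s_A} ⟦A⟧ in Dedukti, where s_A is the (unique) sort with Γ ⊢ A : s_A. -/

import Mathlib

namespace DKPaper

inductive Tm (C : Type) : Type
  | var : Nat → Tm C
  | const : C → List (Tm C) → Tm C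
  | type : Tm C
  | kind : Tm C
  | app : Tm C → Tm C → Tm C
  | lam : Tm C → Tm C → Tm C
  | pi : Tm C → Tm C → Tm C

namespace Tm
variable {C : Type}

def liftRen (ρ : Nat → Nat) : Nat → Nat
  | 0 => 0
  | n + 1 => ρ n + 1

def ren (ρ : Nat → Nat) : Tm C → Tm C
  | var n => var (ρ n)
  | const c Ms => const c (Ms.attach.map fun x => ren ρ x.1)
  | type => type
  | kind => kind
  | app M N => app (ren ρ M) (ren ρ N)
  | lam A M => lam (ren ρ A) (ren (liftRen ρ) M)
  | pi A B => pi (ren ρ A) (ren (liftRen ρ) B)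
termination_by t => sizeOf t
decreasing_by
  all_goals simp_wf
  all_goals try omega
  all_goals (have h := List.sizeOf_lt_of_mem x.2; omega)

def liftSub (σ : Nat → Tm C) : Nat → Tm C
  | 0 => var 0
  | n + 1 => ren Nat.succ (σ n)

def sub (σ : Nat → Tm C) : Tm C → Tm C
  | var n => σ n
  | const c Ms => const c (Ms.attach.map fun x => sub σ x.1)
  | type => type
  | kind => kind
  | app M N => app (sub σ M) (sub σ N)
  | lam A M => lam (sub σ A) (sub (liftSub σ) M)
  | pi A B => pi (sub σ A) (sub (liftSub σ) B)
termination_by t => sizeOf t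
decreasing_by
  all_goals simp_wf
  all_goals try omega
  all_goals (have h := List.sizeOf_lt_of_mem x.2; omega)

/-- Substitution of `N` for the variable of de Bruijn index `k` (the usual `M{N/x}`). -/
def substAt (k : Nat) (N : Tm C) : Tm C → Tm C :=
  sub fun n => if n < k then var n else if n = k then ren (· + k) N else var (n - 1)

end Tm

/-! ## Signatures, rewrite rules, rewriting -/

/-- An entry `c[Δ] : A` of a signature: head constant, telescope (in declaration
order, each entry a type under the previous ones), and the type. -/
abbrev Sig (C : Type) := Set (C × List (Tm C) × Tm C)

/-- A rewrite rule `c[l⃗] ↪ r`: head constant, list of left-hand side argument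
patterns (free de Bruijn variables are the pattern variables), right-hand side. -/
abbrev Rules (C : Type) := Set (C × List (Tm C) × Tm C)

variable {C : Type}

/-- Closure of a root relation under all term-forming contexts. -/
inductive Cong (r : Tm C → Tm C → Prop) : Tm C → Tm C → Prop
  | base {M N} : r M N → Cong r M N
  | appL {M M' N} : Cong r M M' → Cong r (.app M N) (.app M' N)
  | appR {M N N'} : Cong r N N' → Cong r (.app M N) (.app M N')
  | lamA {A A' M} : Cong r A A' → Cong r (.lam A M) (.lam A' M)
  | lamM {A M M'} : Cong r M M' → Cong r (.lam A M) (.lam A M')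
  | piA {A A' B} : Cong r A A' → Cong r (.pi A B) (.pi A' B)
  | piB {A B B'} : Cong r B B' → Cong r (.pi A B) (.pi A B')
  | constArg {c l₁ M M' l₂} : Cong r M M' →
      Cong r (.const c (l₁ ++ M :: l₂)) (.const c (l₁ ++ M' :: l₂))

/-- Root β-reduction. -/
def BetaRoot : Tm C → Tm C → Prop := fun M N =>
  ∃ A P Q, M = .app (.lam A P) Q ∧ N = Tm.substAt 0 Q P

/-- Root reduction by a rule of `R`: a substitution instance of some rule. -/
def RuleRoot (R : Rules C) : Tm C → Tm C → Prop := fun M N =>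
  ∃ rl ∈ R, ∃ σ : Nat → Tm C,
    M = Tm.sub σ (.const rl.1 rl.2.1) ∧ N = Tm.sub σ rl.2.2

/-- One-step β-reduction `↪_β`. -/
def Beta : Tm C → Tm C → Prop := Cong BetaRoot

/-- One-step reduction by the rules of `R` only (no β). -/
def RStep (R : Rules C) : Tm C → Tm C → Prop := Cong (RuleRoot R)

/-- One-step reduction `↪_{β𝓡}`. -/
def Step (R : Rules C) : Tm C → Tm C → Prop :=
  Cong (fun M N => BetaRoot M N ∨ RuleRoot R M N)

/-- The conversion `≡_{β𝓡}` generated by `↪_{β𝓡}`. -/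
def Conv (R : Rules C) : Tm C → Tm C → Prop := Relation.EqvGen (Step R)

/-- Confluence of an abstract reduction relation. -/
def Confluent {α : Type _} (r : α → α → Prop) : Prop :=
  ∀ a b c, Relation.ReflTransGen r a b → Relation.ReflTransGen r a c →
    ∃ d, Relation.ReflTransGen r b d ∧ Relation.ReflTransGen r c d

/-- `M` is in β-normal form. -/
def BetaNormal (M : Tm C) : Prop := ∀ N, ¬ Beta M N

/-- Strong normalization of a relation at a point: no infinite `r`-sequence starts at `a`. -/
def SN {α : Type _} (r : α → α → Prop) (a : α) : Prop := Acc (fun x y => r y x) a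

/-! ## Dedukti typing -/

/-- `IsDKSort s` means `s` is `TYPE` or `KIND`. -/
def IsDKSort (s : Tm C) : Prop := s = Tm.type ∨ s = Tm.kind

/-- `A{M⃗}`: simultaneous instantiation of the telescope variables by the arguments. -/
def instArgs (Ms : List (Tm C)) (A : Tm C) : Tm C :=
  Tm.sub (fun n => Ms.reverse.getD n (Tm.var (n - Ms.length))) A

/-- Instantiate the first variable of the (remaining) telescope `Δ` with `M`. -/
def instTele (M : Tm C) (Δ : List (Tm C)) : List (Tm C) :=
  Δ.mapIdx fun i B => Tm.substAt i M B

mutual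
/-- Well-formed contexts `Σ;Γ well-formed` (de Bruijn: last declaration first). -/
inductive Wf (S : Sig C) (R : Rules C) : List (Tm C) → Prop
  | empty : Wf S R []
  | decl {Γ A} : Typed S R Γ A Tm.type → Wf S R (A :: Γ)

/-- The Dedukti typing judgment `Σ;Γ ⊢ M : A`. -/
inductive Typed (S : Sig C) (R : Rules C) : List (Tm C) → Tm C → Tm C → Prop
  | sort {Γ} : Wf S R Γ → Typed S R Γ Tm.type Tm.kind
  | var {Γ n A} : Wf S R Γ → Γ[n]? = some A →
      Typed S R Γ (Tm.var n) (Tm.ren (· + (n + 1)) A)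
  | cons {Γ c Δ A s Ms} : (c, Δ, A) ∈ S → Typed S R Δ.reverse A s → IsDKSort s →
      TypedArgs S R Γ Ms Δ → Typed S R Γ (Tm.const c Ms) (instArgs Ms A)
  | conv {Γ M A B s} : Typed S R Γ M A → Typed S R Γ B s → IsDKSort s →
      Conv R A B → Typed S R Γ M B
  | prod {Γ A B s} : Typed S R Γ A Tm.type → Typed S R (A :: Γ) B s → IsDKSort s →
      Typed S R Γ (Tm.pi A B) s
  | abs {Γ A B s M} : Typed S R Γ A Tm.type → Typed S R (A :: Γ) B s → IsDKSort s →
      Typed S R (A :: Γ) M B → Typed S R Γ (Tm.lam A M) (Tm.pi A B)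
  | app {Γ M N A B} : Typed S R Γ M (Tm.pi A B) → Typed S R Γ N A →
      Typed S R Γ (Tm.app M N) (Tm.substAt 0 N B)

/-- `Σ;Γ ⊢ M⃗ : Δ`: the arguments fit the telescope. -/
inductive TypedArgs (S : Sig C) (R : Rules C) : List (Tm C) → List (Tm C) → List (Tm C) → Prop
  | nil {Γ} : TypedArgs S R Γ [] []
  | cons {Γ M Ms A Δ} : Typed S R Γ M A → TypedArgs S R Γ Ms (instTele M Δ) →
      TypedArgs S R Γ (M :: Ms) (A :: Δ)
end

/-! ## Type-level and object-level constants, syntactic classes -/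

/-- Types of the form `Πx⃗:B⃗.TYPE`. -/
inductive IsKindShape : Tm C → Prop
  | type : IsKindShape Tm.type
  | pi {A K} : IsKindShape K → IsKindShape (Tm.pi A K)

/-- `c` is a type-level constant of the signature `S`. -/
def TypeLevel (S : Sig C) (c : C) : Prop := ∃ Δ A, (c, Δ, A) ∈ S ∧ IsKindShape A

/-- `c` is an object-level constant of the signature `S`: it is declared, and not type-level. -/
def ObjLevel (S : Sig C) (c : C) : Prop := (∃ Δ A, (c, Δ, A) ∈ S) ∧ ¬ TypeLevel S c

mutual
/-- Kinds: `K ::= TYPE | Πx:T.K`. -/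
inductive IsKind (S : Sig C) : Tm C → Prop
  | type : IsKind S Tm.type
  | pi {T K} : IsTypeFam S T → IsKind S K → IsKind S (Tm.pi T K)

/-- Type families: `T ::= α[O⃗] | T O | λx:T.T | Πx:T.T` with `α` type-level. -/
inductive IsTypeFam (S : Sig C) : Tm C → Prop
  | const {c Os} : TypeLevel S c → (∀ O ∈ Os, IsObj S O) → IsTypeFam S (Tm.const c Os)
  | app {T O} : IsTypeFam S T → IsObj S O → IsTypeFam S (Tm.app T O)
  | lam {T₁ T₂} : IsTypeFam S T₁ → IsTypeFam S T₂ → IsTypeFam S (Tm.lam T₁ T₂)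
  | pi {T₁ T₂} : IsTypeFam S T₁ → IsTypeFam S T₂ → IsTypeFam S (Tm.pi T₁ T₂)

/-- Objects: `O ::= x | a[O⃗] | O O | λx:T.O` with `a` object-level. -/
inductive IsObj (S : Sig C) : Tm C → Prop
  | var {n} : IsObj S (Tm.var n)
  | const {c Os} : ObjLevel S c → (∀ O ∈ Os, IsObj S O) → IsObj S (Tm.const c Os)
  | app {O₁ O₂} : IsObj S O₁ → IsObj S O₂ → IsObj S (Tm.app O₁ O₂)
  | lam {T O} : IsTypeFam S T → IsObj S O → IsObj S (Tm.lam T O)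
end

mutual
/-- Pre-kinds: `L ::= TYPE | Πx:R.L`. -/
inductive PreKind (S : Sig C) : Tm C → Prop
  | type : PreKind S Tm.type
  | pi {R L} : PreTypeFam S R → PreKind S L → PreKind S (Tm.pi R L)

/-- Pre-type families: `R ::= α[M⃗] | R N | λx:A.R | Πx:R.R` with `α` type-level
and `M⃗`, `N`, `A` arbitrary. -/
inductive PreTypeFam (S : Sig C) : Tm C → Prop
  | const {c Ms} : TypeLevel S c → PreTypeFam S (Tm.const c Ms)
  | app {R N} : PreTypeFam S R → PreTypeFam S (Tm.app R N)
  | lam {A R} : PreTypeFam S R → PreTypeFam S (Tm.lam A R)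
  | pi {R₁ R₂} : PreTypeFam S R₁ → PreTypeFam S R₂ → PreTypeFam S (Tm.pi R₁ R₂)
end

/-- A rewrite rule is type-level when its head constant is type-level. -/
def TypeLevelRule (S : Sig C) (rl : C × List (Tm C) × Tm C) : Prop := TypeLevel S rl.1

/-- The grammar `R ::= α[M⃗] | R N | λx:A.R` used to define arity preservation. -/
inductive APShape (S : Sig C) : Tm C → Prop
  | const {c Ms} : TypeLevel S c → APShape S (Tm.const c Ms)
  | app {R N} : APShape S R → APShape S (Tm.app R N)
  | lam {A R} : APShape S R → APShape S (Tm.lam A R)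

/-- `𝓡` is arity preserving (w.r.t. `Σ`). -/
def ArityPreserving (S : Sig C) (R : Rules C) : Prop :=
  ∀ rl ∈ R, TypeLevelRule S rl → APShape S rl.2.2

/-- `𝓡` is well-formed (w.r.t. `Σ`): right-hand sides of type-level rules are in
the grammar `R ::= α[M⃗] | R N | λx:B.R | Πx:R.R`. -/
def RulesWellFormed (S : Sig C) (R : Rules C) : Prop :=
  ∀ rl ∈ R, TypeLevelRule S rl → PreTypeFam S rl.2.2

/-! ## Simple types and the erasure maps -/

/-- Simple types `σ ::= * | σ → σ`. -/
inductive STy : Type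
  | star : STy
  | arr : STy → STy → STy
deriving DecidableEq

open Classical in
/-- The partial type erasure `⌈·⌉` from Dedukti terms to simple types. -/
noncomputable def tyErase (S : Sig C) : Tm C → Option STy
  | Tm.type => some STy.star
  | Tm.const c _ => if TypeLevel S c then some STy.star else none
  | Tm.pi A B => do return STy.arr (← tyErase S A) (← tyErase S B)
  | Tm.app A _ => tyErase S A
  | Tm.lam _ B => tyErase S B
  | Tm.var _ => none
  | Tm.kind => none

/-- Untyped λ-terms with constants in `K` (the target of the term erasure). -/
inductive LTm (K : Type) : Type
  | var : Nat → LTm K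
  | const : K → LTm K
  | app : LTm K → LTm K → LTm K
  | lam : LTm K → LTm K

namespace LTm
variable {K : Type}

def liftRen' (ρ : Nat → Nat) : Nat → Nat
  | 0 => 0
  | n + 1 => ρ n + 1

def ren (ρ : Nat → Nat) : LTm K → LTm K
  | var n => var (ρ n)
  | const k => const k
  | app M N => app (ren ρ M) (ren ρ N)
  | lam M => lam (ren (liftRen' ρ) M)

/-- Shift free variables `≥ d` up by one. -/
def shiftAbove (d : Nat) : LTm K → LTm K :=
  ren fun n => if n < d then n else n + 1

def liftSub (σ : Nat → LTm K) : Nat → LTm K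
  | 0 => var 0
  | n + 1 => ren Nat.succ (σ n)

def sub (σ : Nat → LTm K) : LTm K → LTm K
  | var n => σ n
  | const k => const k
  | app M N => app (sub σ M) (sub σ N)
  | lam M => lam (sub (liftSub σ) M)

/-- Substitution `M{N/x}` for the variable of index `k`. -/
def substAt (k : Nat) (N : LTm K) : LTm K → LTm K :=
  sub fun n => if n < k then var n else if n = k then ren (· + k) N else var (n - 1)

end LTm

/-- β-reduction for the (simply-typed) λ-calculus. -/
inductive LBeta {K : Type} : LTm K → LTm K → Prop
  | red {M N} : LBeta (LTm.app (LTm.lam M) N) (LTm.substAt 0 N M)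
  | appL {M M' N} : LBeta M M' → LBeta (LTm.app M N) (LTm.app M' N)
  | appR {M N N'} : LBeta N N' → LBeta (LTm.app M N) (LTm.app M N')
  | lam {M M'} : LBeta M M' → LBeta (LTm.lam M) (LTm.lam M')

/-- The partial term erasure `|·|` from Dedukti terms into the λ-calculus with
constants `C ⊕ STy` (`Sum.inr σ` being the constant `π_σ`). -/
noncomputable def erase (S : Sig C) : Tm C → Option (LTm (C ⊕ STy))
  | Tm.var n => some (LTm.var n)
  | Tm.const c Ms => do
      let ts ← Ms.attach.mapM fun x => erase S x.1
      return ts.foldl LTm.app (LTm.const (Sum.inl c))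
  | Tm.app M N => do return LTm.app (← erase S M) (← erase S N)
  | Tm.lam A M => do
      return LTm.app (LTm.lam (LTm.lam (LTm.shiftAbove 1 (← erase S M)))) (← erase S A)
  | Tm.pi A B => do
      return LTm.app (LTm.app (LTm.const (Sum.inr (← tyErase S A))) (← erase S A))
        (LTm.lam (← erase S B))
  | Tm.type => none
  | Tm.kind => none
termination_by t => sizeOf t
decreasing_by
  all_goals simp_wf
  all_goals try omega
  all_goals (have h := List.sizeOf_lt_of_mem x.2; omega)

/-- The type `* → (σ → *) → *` of the constant `π_σ`. -/
def piConstTy (σ : STy) : STy := STy.arr STy.star (STy.arr (STy.arr σ STy.star) STy.star)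

/-- `⌈A₁⌉ → ... → ⌈Aₙ⌉ → ⌈A⌉`, as a relation (defined when all erasures are). -/
inductive EraseTele (S : Sig C) : List (Tm C) → Tm C → STy → Prop
  | nil {A σ} : tyErase S A = some σ → EraseTele S [] A σ
  | cons {B Δ A τ σ} : tyErase S B = some τ → EraseTele S Δ A σ →
      EraseTele S (B :: Δ) A (STy.arr τ σ)

/-- The simply-typed constant context `Γ_π, ⌈Σ'⌉`: it declares `π_σ : * → (σ → *) → *`
for every simple type `σ`, and `c : ⌈A₁⌉ → ... → ⌈Aₙ⌉ → ⌈A⌉` for every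
declaration `c[x₁:A₁,...,xₙ:Aₙ] : A` of `Σ'` (erasures being taken w.r.t. `S`). -/
inductive ConstTy (S : Sig C) (S' : Sig C) : C ⊕ STy → STy → Prop
  | piConst (σ : STy) : ConstTy S S' (Sum.inr σ) (piConstTy σ)
  | const {c Δ A σ} : (c, Δ, A) ∈ S' → EraseTele S Δ A σ → ConstTy S S' (Sum.inl c) σ

/-- Typing in the simply-typed λ-calculus, with constants typed by `cty`. -/
inductive STTyped {K : Type} (cty : K → STy → Prop) : List STy → LTm K → STy → Prop
  | var {Γ n σ} : Γ[n]? = some σ → STTyped cty Γ (LTm.var n) σ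
  | const {Γ k σ} : cty k σ → STTyped cty Γ (LTm.const k) σ
  | app {Γ M N σ τ} : STTyped cty Γ M (STy.arr σ τ) → STTyped cty Γ N σ →
      STTyped cty Γ (LTm.app M N) τ
  | lam {Γ M σ τ} : STTyped cty (σ :: Γ) M τ → STTyped cty Γ (LTm.lam M) (STy.arr σ τ)

/-! ## Explicitly-typed Pure Type Systems (EPTS) -/

/-- EPTS terms (de Bruijn): `x | s | Π_{s₁,s₂}(A,[x]B) | λ_{s₁,s₂}(A,[x]B,[x]M) |
@_{s₁,s₂}(A,[x]B,M,N)`. -/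
inductive ETm (S : Type) : Type
  | var : Nat → ETm S
  | sort : S → ETm S
  | pi : S → S → ETm S → ETm S → ETm S
  | lam : S → S → ETm S → ETm S → ETm S → ETm S
  | app : S → S → ETm S → ETm S → ETm S → ETm S → ETm S

namespace ETm
variable {S : Type}

def ren (ρ : Nat → Nat) : ETm S → ETm S
  | var n => var (ρ n)
  | sort s => sort s
  | pi s₁ s₂ A B => pi s₁ s₂ (ren ρ A) (ren (Tm.liftRen ρ) B)
  | lam s₁ s₂ A B M => lam s₁ s₂ (ren ρ A) (ren (Tm.liftRen ρ) B) (ren (Tm.liftRen ρ) M)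
  | app s₁ s₂ A B M N => app s₁ s₂ (ren ρ A) (ren (Tm.liftRen ρ) B) (ren ρ M) (ren ρ N)

def liftSub (σ : Nat → ETm S) : Nat → ETm S
  | 0 => var 0
  | n + 1 => ren Nat.succ (σ n)

def sub (σ : Nat → ETm S) : ETm S → ETm S
  | var n => σ n
  | sort s => sort s
  | pi s₁ s₂ A B => pi s₁ s₂ (sub σ A) (sub (liftSub σ) B)
  | lam s₁ s₂ A B M => lam s₁ s₂ (sub σ A) (sub (liftSub σ) B) (sub (liftSub σ) M)
  | app s₁ s₂ A B M N => app s₁ s₂ (sub σ A) (sub (liftSub σ) B) (sub σ M) (sub σ N)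

/-- Substitution `M{N/x}` for the variable of de Bruijn index `k`. -/
def substAt (k : Nat) (N : ETm S) : ETm S → ETm S :=
  sub fun n => if n < k then var n else if n = k then ren (· + k) N else var (n - 1)

end ETm

variable {S : Type}

/-- Closure of a root relation under all EPTS term-forming contexts. -/
inductive ECong (r : ETm S → ETm S → Prop) : ETm S → ETm S → Prop
  | base {M N} : r M N → ECong r M N
  | piA {s₁ s₂ A A' B} : ECong r A A' → ECong r (.pi s₁ s₂ A B) (.pi s₁ s₂ A' B)
  | piB {s₁ s₂ A B B'} : ECong r B B' → ECong r (.pi s₁ s₂ A B) (.pi s₁ s₂ A B')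
  | lamA {s₁ s₂ A A' B M} : ECong r A A' → ECong r (.lam s₁ s₂ A B M) (.lam s₁ s₂ A' B M)
  | lamB {s₁ s₂ A B B' M} : ECong r B B' → ECong r (.lam s₁ s₂ A B M) (.lam s₁ s₂ A B' M)
  | lamM {s₁ s₂ A B M M'} : ECong r M M' → ECong r (.lam s₁ s₂ A B M) (.lam s₁ s₂ A B M')
  | appA {s₁ s₂ A A' B M N} : ECong r A A' → ECong r (.app s₁ s₂ A B M N) (.app s₁ s₂ A' B M N)
  | appB {s₁ s₂ A B B' M N} : ECong r B B' → ECong r (.app s₁ s₂ A B M N) (.app s₁ s₂ A B' M N)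
  | appM {s₁ s₂ A B M M' N} : ECong r M M' → ECong r (.app s₁ s₂ A B M N) (.app s₁ s₂ A B M' N)
  | appN {s₁ s₂ A B M N N'} : ECong r N N' → ECong r (.app s₁ s₂ A B M N) (.app s₁ s₂ A B M N')

/-- Root β-reduction of the EPTS (linearized rule, one instance per `(s₁,s₂,s₃) ∈ ℛ`):
`@_{s₁,s₂}(A,[x]B, λ_{s₁,s₂}(A',[x]B',[x]M), N) ↪ M{N/x}`. -/
def EBetaRoot (Rrel : S → S → S → Prop) : ETm S → ETm S → Prop := fun M N =>
  ∃ s₁ s₂ s₃ A B A' B' P Q, Rrel s₁ s₂ s₃ ∧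
    M = ETm.app s₁ s₂ A B (ETm.lam s₁ s₂ A' B' P) Q ∧ N = ETm.substAt 0 Q P

/-- One-step EPTS reduction. -/
def EStep (Rrel : S → S → S → Prop) : ETm S → ETm S → Prop := ECong (EBetaRoot Rrel)

/-- EPTS conversion `≡`. -/
def EConv (Rrel : S → S → S → Prop) : ETm S → ETm S → Prop := Relation.EqvGen (EStep Rrel)

mutual
/-- Well-formed EPTS contexts. -/
inductive EWf (Ar : S → S → Prop) (Rr : S → S → S → Prop) : List (ETm S) → Prop
  | empty : EWf Ar Rr []
  | decl {Γ A s} : ETyped Ar Rr Γ A (ETm.sort s) → EWf Ar Rr (A :: Γ)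

/-- The EPTS typing judgment `Γ ⊢ M : A`. -/
inductive ETyped (Ar : S → S → Prop) (Rr : S → S → S → Prop) : List (ETm S) → ETm S → ETm S → Prop
  | sort {Γ s₁ s₂} : EWf Ar Rr Γ → Ar s₁ s₂ → ETyped Ar Rr Γ (ETm.sort s₁) (ETm.sort s₂)
  | var {Γ n A} : EWf Ar Rr Γ → Γ[n]? = some A →
      ETyped Ar Rr Γ (ETm.var n) (ETm.ren (· + (n + 1)) A)
  | conv {Γ M A B s} : ETyped Ar Rr Γ M A → ETyped Ar Rr Γ B (ETm.sort s) →
      EConv Rr A B → ETyped Ar Rr Γ M B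
  | pi {Γ s₁ s₂ s₃ A B} : Rr s₁ s₂ s₃ → ETyped Ar Rr Γ A (ETm.sort s₁) →
      ETyped Ar Rr (A :: Γ) B (ETm.sort s₂) →
      ETyped Ar Rr Γ (ETm.pi s₁ s₂ A B) (ETm.sort s₃)
  | lam {Γ s₁ s₂ s₃ A B M} : Rr s₁ s₂ s₃ → ETyped Ar Rr Γ A (ETm.sort s₁) →
      ETyped Ar Rr (A :: Γ) B (ETm.sort s₂) → ETyped Ar Rr (A :: Γ) M B →
      ETyped Ar Rr Γ (ETm.lam s₁ s₂ A B M) (ETm.pi s₁ s₂ A B)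
  | app {Γ s₁ s₂ s₃ A B M N} : Rr s₁ s₂ s₃ → ETyped Ar Rr Γ A (ETm.sort s₁) →
      ETyped Ar Rr (A :: Γ) B (ETm.sort s₂) → ETyped Ar Rr Γ N A →
      ETyped Ar Rr Γ M (ETm.pi s₁ s₂ A B) →
      ETyped Ar Rr Γ (ETm.app s₁ s₂ A B M N) (ETm.substAt 0 N B)
end

/-- `𝒜` and `ℛ` are functional relations. -/
def FunctionalSpec (Ar : S → S → Prop) (Rr : S → S → S → Prop) : Prop :=
  (∀ s t t', Ar s t → Ar s t' → t = t') ∧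
  (∀ s₁ s₂ t t', Rr s₁ s₂ t → Rr s₁ s₂ t' → t = t')

/-- `s` is a top-sort. -/
def IsTopSort (Ar : S → S → Prop) (s : S) : Prop := ¬ ∃ s', Ar s s'

/-- `Γ ⊢ A type`: `A` is a sort, or `Γ ⊢ A : s` for some sort `s`. -/
def ETypeJ (Ar : S → S → Prop) (Rr : S → S → S → Prop) (Γ : List (ETm S)) (A : ETm S) : Prop :=
  (∃ s, A = ETm.sort s) ∨ ∃ s, ETyped Ar Rr Γ A (ETm.sort s)

/-! ## (Implicit) Pure Type Systems -/

/-- PTS terms. -/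
inductive PTm (S : Type) : Type
  | var : Nat → PTm S
  | sort : S → PTm S
  | pi : PTm S → PTm S → PTm S
  | lam : PTm S → PTm S → PTm S
  | app : PTm S → PTm S → PTm S

namespace PTm
variable {S : Type}

def ren (ρ : Nat → Nat) : PTm S → PTm S
  | var n => var (ρ n)
  | sort s => sort s
  | pi A B => pi (ren ρ A) (ren (Tm.liftRen ρ) B)
  | lam A M => lam (ren ρ A) (ren (Tm.liftRen ρ) M)
  | app M N => app (ren ρ M) (ren ρ N)

def liftSub (σ : Nat → PTm S) : Nat → PTm S
  | 0 => var 0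
  | n + 1 => ren Nat.succ (σ n)

def sub (σ : Nat → PTm S) : PTm S → PTm S
  | var n => σ n
  | sort s => sort s
  | pi A B => pi (sub σ A) (sub (liftSub σ) B)
  | lam A M => lam (sub σ A) (sub (liftSub σ) M)
  | app M N => app (sub σ M) (sub σ N)

def substAt (k : Nat) (N : PTm S) : PTm S → PTm S :=
  sub fun n => if n < k then var n else if n = k then ren (· + k) N else var (n - 1)

end PTm

/-- One-step β-reduction of PTS terms. -/
inductive PBeta : PTm S → PTm S → Prop
  | red {A M N} : PBeta (PTm.app (PTm.lam A M) N) (PTm.substAt 0 N M)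
  | piA {A A' B} : PBeta A A' → PBeta (PTm.pi A B) (PTm.pi A' B)
  | piB {A B B'} : PBeta B B' → PBeta (PTm.pi A B) (PTm.pi A B')
  | lamA {A A' M} : PBeta A A' → PBeta (PTm.lam A M) (PTm.lam A' M)
  | lamM {A M M'} : PBeta M M' → PBeta (PTm.lam A M) (PTm.lam A M')
  | appL {M M' N} : PBeta M M' → PBeta (PTm.app M N) (PTm.app M' N)
  | appR {M N N'} : PBeta N N' → PBeta (PTm.app M N) (PTm.app M N')

/-- PTS conversion. -/
def PConv : PTm S → PTm S → Prop := Relation.EqvGen PBeta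

mutual
/-- Well-formed PTS contexts. -/
inductive PWf (Ar : S → S → Prop) (Rr : S → S → S → Prop) : List (PTm S) → Prop
  | empty : PWf Ar Rr []
  | decl {Γ A s} : PTyped Ar Rr Γ A (PTm.sort s) → PWf Ar Rr (A :: Γ)

/-- The PTS typing judgment. -/
inductive PTyped (Ar : S → S → Prop) (Rr : S → S → S → Prop) : List (PTm S) → PTm S → PTm S → Prop
  | sort {Γ s₁ s₂} : PWf Ar Rr Γ → Ar s₁ s₂ → PTyped Ar Rr Γ (PTm.sort s₁) (PTm.sort s₂)
  | var {Γ n A} : PWf Ar Rr Γ → Γ[n]? = some A →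
      PTyped Ar Rr Γ (PTm.var n) (PTm.ren (· + (n + 1)) A)
  | conv {Γ M A B s} : PTyped Ar Rr Γ M A → PTyped Ar Rr Γ B (PTm.sort s) →
      PConv A B → PTyped Ar Rr Γ M B
  | pi {Γ s₁ s₂ s₃ A B} : Rr s₁ s₂ s₃ → PTyped Ar Rr Γ A (PTm.sort s₁) →
      PTyped Ar Rr (A :: Γ) B (PTm.sort s₂) →
      PTyped Ar Rr Γ (PTm.pi A B) (PTm.sort s₃)
  | lam {Γ s₁ s₂ s₃ A B M} : Rr s₁ s₂ s₃ → PTyped Ar Rr Γ A (PTm.sort s₁) →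
      PTyped Ar Rr (A :: Γ) B (PTm.sort s₂) → PTyped Ar Rr (A :: Γ) M B →
      PTyped Ar Rr Γ (PTm.lam A M) (PTm.pi A B)
  | app {Γ A B M N} : PTyped Ar Rr Γ M (PTm.pi A B) → PTyped Ar Rr Γ N A →
      PTyped Ar Rr Γ (PTm.app M N) (PTm.substAt 0 N B)
end

/-- `Γ ⊢_PTS A type`. -/
def PTypeJ (Ar : S → S → Prop) (Rr : S → S → S → Prop) (Γ : List (PTm S)) (A : PTm S) : Prop :=
  (∃ s, A = PTm.sort s) ∨ ∃ s, PTyped Ar Rr Γ A (PTm.sort s)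

/-- The natural erasure from EPTS terms to PTS terms. -/
def epsErase : ETm S → PTm S
  | ETm.var n => PTm.var n
  | ETm.sort s => PTm.sort s
  | ETm.pi _ _ A B => PTm.pi (epsErase A) (epsErase B)
  | ETm.lam _ _ A _ M => PTm.lam (epsErase A) (epsErase M)
  | ETm.app _ _ _ _ M N => PTm.app (epsErase M) (epsErase N)

/-! ## The encoding of EPTSs in Dedukti -/

/-- The constants of the theory `(Σ_EPTS, 𝓡_EPTS)`. -/
inductive EConst (S : Type) : Type
  | U : S → EConst S
  | El : S → EConst S
  | u : S → EConst S
  | Prod : S → S → EConst S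
  | abs : S → S → EConst S
  | app : S → S → EConst S

/-- `U_s`. -/
def Ucon (s : S) : Tm (EConst S) := Tm.const (EConst.U s) []
/-- `El_s A`. -/
def Elcon (s : S) (A : Tm (EConst S)) : Tm (EConst S) := Tm.const (EConst.El s) [A]
/-- `u_s`. -/
def ucon (s : S) : Tm (EConst S) := Tm.const (EConst.u s) []
/-- `Prod_{s₁,s₂} A B`. -/
def ProdC (s₁ s₂ : S) (A B : Tm (EConst S)) : Tm (EConst S) :=
  Tm.const (EConst.Prod s₁ s₂) [A, B]
/-- `abs_{s₁,s₂} A B M`. -/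
def absC (s₁ s₂ : S) (A B M : Tm (EConst S)) : Tm (EConst S) :=
  Tm.const (EConst.abs s₁ s₂) [A, B, M]
/-- `app_{s₁,s₂} A B M N`. -/
def appC (s₁ s₂ : S) (A B M N : Tm (EConst S)) : Tm (EConst S) :=
  Tm.const (EConst.app s₁ s₂) [A, B, M, N]

/-- The signature `Σ_EPTS` (telescopes in de Bruijn form). -/
inductive SigEPTSMem (Ar : S → S → Prop) (Rr : S → S → S → Prop) :
    EConst S × List (Tm (EConst S)) × Tm (EConst S) → Prop
  | U (s : S) : SigEPTSMem Ar Rr (EConst.U s, [], Tm.type)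
  | El (s : S) : SigEPTSMem Ar Rr (EConst.El s, [Ucon s], Tm.type)
  | u {s₁ s₂} : Ar s₁ s₂ → SigEPTSMem Ar Rr (EConst.u s₁, [], Ucon s₂)
  | Prod {s₁ s₂ s₃} : Rr s₁ s₂ s₃ →
      SigEPTSMem Ar Rr (EConst.Prod s₁ s₂,
        [Ucon s₁, Tm.pi (Elcon s₁ (Tm.var 0)) (Ucon s₂)],
        Ucon s₃)
  | abs {s₁ s₂ s₃} : Rr s₁ s₂ s₃ →
      SigEPTSMem Ar Rr (EConst.abs s₁ s₂,
        [Ucon s₁, Tm.pi (Elcon s₁ (Tm.var 0)) (Ucon s₂),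
         Tm.pi (Elcon s₁ (Tm.var 1)) (Elcon s₂ (Tm.app (Tm.var 1) (Tm.var 0)))],
        Elcon s₃ (ProdC s₁ s₂ (Tm.var 2) (Tm.var 1)))
  | app {s₁ s₂ s₃} : Rr s₁ s₂ s₃ →
      SigEPTSMem Ar Rr (EConst.app s₁ s₂,
        [Ucon s₁, Tm.pi (Elcon s₁ (Tm.var 0)) (Ucon s₂),
         Elcon s₃ (ProdC s₁ s₂ (Tm.var 1) (Tm.var 0)),
         Elcon s₁ (Tm.var 2)],
        Elcon s₂ (Tm.app (Tm.var 2) (Tm.var 0)))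

/-- `Σ_EPTS` as a signature. -/
def sigEPTS (Ar : S → S → Prop) (Rr : S → S → S → Prop) : Sig (EConst S) :=
  fun e => SigEPTSMem Ar Rr e

/-- The rules `El_{s₂} u_{s₁} ↪ U_{s₁}` for `(s₁,s₂) ∈ 𝒜`. -/
inductive URulesMem (Ar : S → S → Prop) :
    EConst S × List (Tm (EConst S)) × Tm (EConst S) → Prop
  | u_red {s₁ s₂} : Ar s₁ s₂ → URulesMem Ar (EConst.El s₂, [ucon s₁], Ucon s₁)

/-- The rules `app_{s₁,s₂} A B (abs_{s₁,s₂} A' B' M) N ↪ M N` for `(s₁,s₂,s₃) ∈ ℛ`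
(pattern variables `A,B,A',B',M,N` are the de Bruijn variables `0,…,5`). -/
inductive BetaRulesMem (Rr : S → S → S → Prop) :
    EConst S × List (Tm (EConst S)) × Tm (EConst S) → Prop
  | beta {s₁ s₂ s₃} : Rr s₁ s₂ s₃ →
      BetaRulesMem Rr (EConst.app s₁ s₂,
        [Tm.var 0, Tm.var 1, absC s₁ s₂ (Tm.var 2) (Tm.var 3) (Tm.var 4), Tm.var 5],
        Tm.app (Tm.var 4) (Tm.var 5))

/-- The `u_{s₁}`-red rules as a rule set. -/
def uRules (Ar : S → S → Prop) : Rules (EConst S) := fun e => URulesMem Ar e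

/-- The `beta_{s₁,s₂}` rules as a rule set. -/
def betaRules (Rr : S → S → S → Prop) : Rules (EConst S) := fun e => BetaRulesMem Rr e

/-- The rewrite system `𝓡_EPTS`. -/
def rulesEPTS (Ar : S → S → Prop) (Rr : S → S → S → Prop) : Rules (EConst S) :=
  uRules Ar ∪ betaRules Rr

/-- The translation `⟦·⟧` from EPTS terms to Dedukti terms. -/
def trans : ETm S → Tm (EConst S)
  | ETm.var n => Tm.var n
  | ETm.sort s => ucon s
  | ETm.pi s₁ s₂ A B =>
      ProdC s₁ s₂ (trans A) (Tm.lam (Elcon s₁ (trans A)) (trans B))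
  | ETm.lam s₁ s₂ A B M =>
      absC s₁ s₂ (trans A) (Tm.lam (Elcon s₁ (trans A)) (trans B))
        (Tm.lam (Elcon s₁ (trans A)) (trans M))
  | ETm.app s₁ s₂ A B M N =>
      appC s₁ s₂ (trans A) (Tm.lam (Elcon s₁ (trans A)) (trans B)) (trans M) (trans N)

/-- The translation `⟦·⟧` on (well-formed) contexts: `⟦Γ, x:A⟧ = ⟦Γ⟧, x : El_{s_A} ⟦A⟧`
where `Γ ⊢ A : s_A`. -/
inductive TransCtx (Ar : S → S → Prop) (Rr : S → S → S → Prop) :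
    List (ETm S) → List (Tm (EConst S)) → Prop
  | nil : TransCtx Ar Rr [] []
  | cons {Γ Δ A sA} : TransCtx Ar Rr Γ Δ → ETyped Ar Rr Γ A (ETm.sort sA) →
      TransCtx Ar Rr (A :: Γ) (Elcon sA (trans A) :: Δ)

/-- Invertible forms. -/
inductive Invertible : Tm (EConst S) → Prop
  | var {n} : Invertible (Tm.var n)
  | u {s} : Invertible (ucon s)
  | abs {s₁ s₂ A T₁ B T₂ M} : Invertible A → Invertible B → Invertible M →
      Invertible (absC s₁ s₂ A (Tm.lam T₁ B) (Tm.lam T₂ M))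
  | beta {T M N} : Invertible M → Invertible N →
      Invertible (Tm.app (Tm.lam T M) N)
  | prod {s₁ s₂ A T₁ B} : Invertible A → Invertible B →
      Invertible (ProdC s₁ s₂ A (Tm.lam T₁ B))
  | app {s₁ s₂ A T₁ B M N} : Invertible A → Invertible B → Invertible M → Invertible N →
      Invertible (appC s₁ s₂ A (Tm.lam T₁ B) M N)

/-- The inverse translation `|·|`, defined (at least) on invertible forms. -/
def inv : Tm (EConst S) → Option (ETm S)
  | Tm.var n => some (ETm.var n)
  | Tm.const (EConst.u s) [] => some (ETm.sort s)
  | Tm.app (Tm.lam _ M) N => do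
      return ETm.substAt 0 (← inv N) (← inv M)
  | Tm.const (EConst.Prod s₁ s₂) [A, Tm.lam _ B] => do
      return ETm.pi s₁ s₂ (← inv A) (← inv B)
  | Tm.const (EConst.abs s₁ s₂) [A, Tm.lam _ B, Tm.lam _ M] => do
      return ETm.lam s₁ s₂ (← inv A) (← inv B) (← inv M)
  | Tm.const (EConst.app s₁ s₂) [A, Tm.lam _ B, M, N] => do
      return ETm.app s₁ s₂ (← inv A) (← inv B) (← inv M) (← inv N)
  | _ => none
termination_by t => sizeOf t
decreasing_by
  all_goals simp_wf
  all_goals omega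

/-- Hidden rewriting steps: a `↪_{β𝓡}` step inside the type annotation of a binder. -/
def HStep (R : Rules (EConst S)) : Tm (EConst S) → Tm (EConst S) → Prop :=
  Cong fun M N => ∃ A A' P, Step R A A' ∧ M = Tm.lam A P ∧ N = Tm.lam A' P

/-- The hidden conversion `≡_H`. -/
def HConv (R : Rules (EConst S)) : Tm (EConst S) → Tm (EConst S) → Prop :=
  Relation.EqvGen (HStep R)

/-! ## Substitution calculus -/

/-- The stream `a, σ 0, σ 1, …`, used to instantiate the variable of index `0`. -/
def scons {α : Type} (a : α) (σ : Nat → α) : Nat → α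
  | 0 => a
  | n + 1 => σ n

@[simp] theorem scons_zero {α : Type} (a : α) (σ : Nat → α) : scons a σ 0 = a := rfl

@[simp] theorem scons_succ {α : Type} (a : α) (σ : Nat → α) (n : Nat) :
    scons a σ (n + 1) = σ n := rfl

namespace Tm
variable {C : Type}

@[elab_as_elim]
theorem induction_on_args {P : Tm C → Prop} (var : ∀ n, P (var n))
    (const : ∀ c Ms, (∀ M ∈ Ms, P M) → P (const c Ms)) (type : P type) (kind : P kind)
    (app : ∀ M N, P M → P N → P (app M N)) (lam : ∀ A M, P A → P M → P (lam A M))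
    (pi : ∀ A B, P A → P B → P (pi A B)) (M : Tm C) : P M :=
  Tm.rec (motive_1 := P) (motive_2 := fun Ms => ∀ M ∈ Ms, P M) var const type kind app lam pi
    (by simp) (fun M Ms hM hMs => by simpa using ⟨hM, hMs⟩) M

@[simp] theorem ren_var (ρ : Nat → Nat) (n : Nat) : ren ρ (var n : Tm C) = var (ρ n) := by
  rw [ren]
@[simp] theorem ren_const (ρ : Nat → Nat) (c : C) (Ms : List (Tm C)) :
    ren ρ (const c Ms) = const c (Ms.map (ren ρ)) := by
  rw [ren]; simp
@[simp] theorem ren_type (ρ : Nat → Nat) : ren ρ (type : Tm C) = type := by rw [ren]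
@[simp] theorem ren_kind (ρ : Nat → Nat) : ren ρ (kind : Tm C) = kind := by rw [ren]
@[simp] theorem ren_app (ρ : Nat → Nat) (M N : Tm C) :
    ren ρ (app M N) = app (ren ρ M) (ren ρ N) := by rw [ren]
@[simp] theorem ren_lam (ρ : Nat → Nat) (A M : Tm C) :
    ren ρ (lam A M) = lam (ren ρ A) (ren (liftRen ρ) M) := by rw [ren]
@[simp] theorem ren_pi (ρ : Nat → Nat) (A B : Tm C) :
    ren ρ (pi A B) = pi (ren ρ A) (ren (liftRen ρ) B) := by rw [ren]

@[simp] theorem sub_var (σ : Nat → Tm C) (n : Nat) : sub σ (var n : Tm C) = σ n := by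
  rw [sub]
@[simp] theorem sub_const (σ : Nat → Tm C) (c : C) (Ms : List (Tm C)) :
    sub σ (const c Ms) = const c (Ms.map (sub σ)) := by
  rw [sub]; simp
@[simp] theorem sub_type (σ : Nat → Tm C) : sub σ (type : Tm C) = type := by rw [sub]
@[simp] theorem sub_kind (σ : Nat → Tm C) : sub σ (kind : Tm C) = kind := by rw [sub]
@[simp] theorem sub_app (σ : Nat → Tm C) (M N : Tm C) :
    sub σ (app M N) = app (sub σ M) (sub σ N) := by rw [sub]
@[simp] theorem sub_lam (σ : Nat → Tm C) (A M : Tm C) :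
    sub σ (lam A M) = lam (sub σ A) (sub (liftSub σ) M) := by rw [sub]
@[simp] theorem sub_pi (σ : Nat → Tm C) (A B : Tm C) :
    sub σ (pi A B) = pi (sub σ A) (sub (liftSub σ) B) := by rw [sub]

@[simp] theorem liftSub_zero (σ : Nat → Tm C) : liftSub σ 0 = var 0 := rfl
@[simp] theorem liftSub_succ (σ : Nat → Tm C) (n : Nat) :
    liftSub σ (n + 1) = ren Nat.succ (σ n) := rfl

theorem ren_eq_sub (M : Tm C) : ∀ ρ : Nat → Nat, ren ρ M = sub (fun n => var (ρ n)) M := by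
  have lift (ρ : Nat → Nat) :
      (fun n => var (liftRen ρ n) : Nat → Tm C) = liftSub fun n => var (ρ n) := by
    funext n; cases n <;> simp [liftRen]
  induction M using induction_on_args <;> intro ρ <;> simp_all

theorem sub_ren (ρ : Nat → Nat) (τ : Nat → Tm C) (M : Tm C) :
    sub τ (ren ρ M) = sub (fun n => τ (ρ n)) M := by
  have lift (ρ : Nat → Nat) (τ : Nat → Tm C) :
      (fun n => liftSub τ (liftRen ρ n)) = liftSub fun n => τ (ρ n) := by
    funext n; cases n <;> simp [liftRen]
  induction M using induction_on_args generalizing ρ τ <;> simp_all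

theorem ren_ren (ρ ρ' : Nat → Nat) (M : Tm C) :
    ren ρ' (ren ρ M) = ren (fun n => ρ' (ρ n)) M := by
  rw [ren_eq_sub _ ρ', sub_ren, ren_eq_sub]

theorem ren_sub (σ : Nat → Tm C) (ρ : Nat → Nat) (M : Tm C) :
    ren ρ (sub σ M) = sub (fun n => ren ρ (σ n)) M := by
  have lift (σ : Nat → Tm C) (ρ : Nat → Nat) :
      (fun n => ren (liftRen ρ) (liftSub σ n)) = liftSub fun n => ren ρ (σ n) := by
    funext n; cases n <;> simp [liftRen, ren_ren]
  induction M using induction_on_args generalizing σ ρ <;> simp_all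

theorem sub_sub (σ τ : Nat → Tm C) (M : Tm C) :
    sub τ (sub σ M) = sub (fun n => sub τ (σ n)) M := by
  have lift (σ τ : Nat → Tm C) :
      (fun n => sub (liftSub τ) (liftSub σ n)) = liftSub fun n => sub τ (σ n) := by
    funext n; cases n <;> simp [sub_ren, ren_sub]
  induction M using induction_on_args generalizing σ τ <;> simp_all

@[simp] theorem sub_id (M : Tm C) : sub var M = M := by
  have lift : liftSub (var : Nat → Tm C) = var := by
    funext n; cases n <;> simp
  induction M using induction_on_args with
  | const c Ms ih => simpa using List.map_congr_left (g := id) ih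
  | _ => simp_all

@[simp] theorem ren_id (M : Tm C) : ren (fun n => n) M = M := by
  rw [ren_eq_sub]; exact sub_id M

theorem substAt_zero (N M : Tm C) : substAt 0 N M = sub (scons N var) M := by
  unfold substAt
  congr 1; funext n; cases n <;> simp

theorem sub_liftSub_ren_succ (σ : Nat → Tm C) (M : Tm C) :
    sub (liftSub σ) (ren Nat.succ M) = ren Nat.succ (sub σ M) := by
  simp [sub_ren, ren_sub]

theorem sub_scons_liftSub (N : Tm C) (σ τ : Nat → Tm C) (M : Tm C) :
    sub (scons N τ) (sub (liftSub σ) M) = sub (scons N fun n => sub τ (σ n)) M := by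
  rw [sub_sub]
  congr 1; funext n; cases n <;> simp [sub_ren]

theorem substAt_var_zero_ren (M : Tm C) :
    substAt 0 (var 0) (ren (liftRen Nat.succ) M) = M := by
  rw [substAt_zero, sub_ren]
  convert sub_id M using 2
  funext n; cases n <;> simp [liftRen]

theorem sub_substAt_zero (σ : Nat → Tm C) (N M : Tm C) :
    sub σ (substAt 0 N M) = sub (scons (sub σ N) σ) M := by
  rw [substAt_zero, sub_sub]
  congr 1; funext n; cases n <;> simp

theorem sub_substAt (σ : Nat → Tm C) (N M : Tm C) :
    sub σ (substAt 0 N M) = substAt 0 (sub σ N) (sub (liftSub σ) M) := by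
  rw [sub_substAt_zero, substAt_zero, sub_scons_liftSub]
  simp

end Tm

namespace ETm
variable {S : Type}

@[simp] theorem liftSub_zero (σ : Nat → ETm S) : liftSub σ 0 = var 0 := rfl
@[simp] theorem liftSub_succ (σ : Nat → ETm S) (n : Nat) :
    liftSub σ (n + 1) = ren Nat.succ (σ n) := rfl

theorem ren_eq_sub (M : ETm S) : ∀ ρ : Nat → Nat, ren ρ M = sub (fun n => var (ρ n)) M := by
  have lift (ρ : Nat → Nat) :
      (fun n => var (Tm.liftRen ρ n) : Nat → ETm S) = liftSub fun n => var (ρ n) := by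
    funext n; cases n <;> simp [Tm.liftRen, ren]
  induction M <;> intro ρ <;> simp_all [ren, sub]

theorem sub_ren (ρ : Nat → Nat) (τ : Nat → ETm S) (M : ETm S) :
    sub τ (ren ρ M) = sub (fun n => τ (ρ n)) M := by
  have lift (ρ : Nat → Nat) (τ : Nat → ETm S) :
      (fun n => liftSub τ (Tm.liftRen ρ n)) = liftSub fun n => τ (ρ n) := by
    funext n; cases n <;> simp [Tm.liftRen]
  induction M generalizing ρ τ <;> simp_all [ren, sub]

theorem ren_ren (ρ ρ' : Nat → Nat) (M : ETm S) :
    ren ρ' (ren ρ M) = ren (fun n => ρ' (ρ n)) M := by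
  rw [ren_eq_sub _ ρ', sub_ren, ren_eq_sub]

theorem ren_sub (σ : Nat → ETm S) (ρ : Nat → Nat) (M : ETm S) :
    ren ρ (sub σ M) = sub (fun n => ren ρ (σ n)) M := by
  have lift (σ : Nat → ETm S) (ρ : Nat → Nat) :
      (fun n => ren (Tm.liftRen ρ) (liftSub σ n)) = liftSub fun n => ren ρ (σ n) := by
    funext n; cases n <;> simp [Tm.liftRen, ren_ren, ren]
  induction M generalizing σ ρ <;> simp_all [ren, sub]

theorem sub_sub (σ τ : Nat → ETm S) (M : ETm S) :
    sub τ (sub σ M) = sub (fun n => sub τ (σ n)) M := by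
  have lift (σ τ : Nat → ETm S) :
      (fun n => sub (liftSub τ) (liftSub σ n)) = liftSub fun n => sub τ (σ n) := by
    funext n; cases n <;> simp [sub_ren, ren_sub, sub]
  induction M generalizing σ τ <;> simp_all [sub]

@[simp] theorem sub_id (M : ETm S) : sub var M = M := by
  have lift : liftSub (var : Nat → ETm S) = var := by
    funext n; cases n <;> simp [ren]
  induction M <;> simp_all [sub]

theorem substAt_zero (N M : ETm S) : substAt 0 N M = sub (scons N var) M := by
  unfold substAt
  congr 1; funext n; cases n
  · simp [ren_eq_sub]
  · simp

theorem sub_substAt (σ : Nat → ETm S) (N M : ETm S) :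
    sub σ (substAt 0 N M) = substAt 0 (sub σ N) (sub (liftSub σ) M) := by
  rw [substAt_zero, substAt_zero, sub_sub, sub_sub]
  congr 1; funext n; cases n <;> simp [sub, sub_ren]

theorem ren_substAt (ρ : Nat → Nat) (N M : ETm S) :
    ren ρ (substAt 0 N M) = substAt 0 (ren ρ N) (ren (Tm.liftRen ρ) M) := by
  rw [substAt_zero, substAt_zero, ren_sub, sub_ren]
  congr 1; funext n; cases n <;> simp [ren, Tm.liftRen]

end ETm

theorem trans_ren (ρ : Nat → Nat) (M : ETm S) : trans (ETm.ren ρ M) = Tm.ren ρ (trans M) := by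
  induction M generalizing ρ <;>
    simp_all [ETm.ren, trans, ucon, Elcon, ProdC, absC, appC]

theorem trans_sub (σ : Nat → ETm S) (M : ETm S) :
    trans (ETm.sub σ M) = Tm.sub (fun n => trans (σ n)) (trans M) := by
  have lift (σ : Nat → ETm S) :
      (fun n => trans (ETm.liftSub σ n)) = Tm.liftSub fun n => trans (σ n) := by
    funext n; cases n <;> simp [trans, trans_ren]
  induction M generalizing σ <;>
    simp_all [ETm.sub, trans, ucon, Elcon, ProdC, absC, appC]

theorem trans_substAt (N M : ETm S) :
    trans (ETm.substAt 0 N M) = Tm.substAt 0 (trans N) (trans M) := by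
  rw [ETm.substAt_zero, Tm.substAt_zero, trans_sub]
  congr 1; funext n; cases n <;> simp [trans]

/-! ## Conversion and confluence in an EPTS -/

namespace EConv
variable {Rr : S → S → S → Prop}

theorem refl (M : ETm S) : EConv Rr M M := Relation.EqvGen.refl M

theorem symm {M N : ETm S} (h : EConv Rr M N) : EConv Rr N M := Relation.EqvGen.symm _ _ h

theorem trans {M N P : ETm S} (h : EConv Rr M N) (h' : EConv Rr N P) : EConv Rr M P :=
  Relation.EqvGen.trans _ _ _ h h'

theorem map {f : ETm S → ETm S} (hf : ∀ {M N}, EStep Rr M N → EStep Rr (f M) (f N))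
    {M N : ETm S} (h : EConv Rr M N) : EConv Rr (f M) (f N) := by
  induction h with
  | rel _ _ h => exact .rel _ _ (hf h)
  | refl => exact .refl _
  | symm _ _ _ ih => exact ih.symm
  | trans _ _ _ _ _ ih ih' => exact ih.trans ih'

theorem pi {s₁ s₂ : S} {A A' B B' : ETm S} (hA : EConv Rr A A') (hB : EConv Rr B B') :
    EConv Rr (.pi s₁ s₂ A B) (.pi s₁ s₂ A' B') :=
  (hA.map (f := (.pi s₁ s₂ · B)) .piA).trans (hB.map (f := (.pi s₁ s₂ A' ·)) .piB)

theorem lam {s₁ s₂ : S} {A A' B B' M M' : ETm S} (hA : EConv Rr A A') (hB : EConv Rr B B')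
    (hM : EConv Rr M M') : EConv Rr (.lam s₁ s₂ A B M) (.lam s₁ s₂ A' B' M') :=
  (hA.map (f := (.lam s₁ s₂ · B M)) .lamA).trans <|
    (hB.map (f := (.lam s₁ s₂ A' · M)) .lamB).trans (hM.map (f := (.lam s₁ s₂ A' B' ·)) .lamM)

theorem app {s₁ s₂ : S} {A A' B B' M M' N N' : ETm S} (hA : EConv Rr A A')
    (hB : EConv Rr B B') (hM : EConv Rr M M') (hN : EConv Rr N N') :
    EConv Rr (.app s₁ s₂ A B M N) (.app s₁ s₂ A' B' M' N') :=
  (hA.map (f := (.app s₁ s₂ · B M N)) .appA).trans <|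
    (hB.map (f := (.app s₁ s₂ A' · M N)) .appB).trans <|
      (hM.map (f := (.app s₁ s₂ A' B' · N)) .appM).trans
        (hN.map (f := (.app s₁ s₂ A' B' M' ·)) .appN)

theorem beta {s₁ s₂ s₃ : S} (hR : Rr s₁ s₂ s₃) (A B A' B' M N : ETm S) :
    EConv Rr (.app s₁ s₂ A B (.lam s₁ s₂ A' B' M) N) (ETm.substAt 0 N M) :=
  .rel _ _ (.base ⟨s₁, s₂, s₃, A, B, A', B', M, N, hR, rfl, rfl⟩)

end EConv

theorem EStep.sub {Rr : S → S → S → Prop} {M N : ETm S} (h : EStep Rr M N)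
    (σ : Nat → ETm S) : EStep Rr (M.sub σ) (N.sub σ) := by
  unfold EStep at *
  induction h generalizing σ with
  | base h =>
    obtain ⟨s₁, s₂, s₃, A, B, A', B', P, Q, hR, rfl, rfl⟩ := h
    exact .base ⟨s₁, s₂, s₃, _, _, _, _, _, _, hR, rfl, ETm.sub_substAt σ Q P⟩
  | piA _ ih => exact .piA (ih σ)
  | piB _ ih => exact .piB (ih _)
  | lamA _ ih => exact .lamA (ih σ)
  | lamB _ ih => exact .lamB (ih _)
  | lamM _ ih => exact .lamM (ih _)
  | appA _ ih => exact .appA (ih σ)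
  | appB _ ih => exact .appB (ih _)
  | appM _ ih => exact .appM (ih σ)
  | appN _ ih => exact .appN (ih σ)

theorem EConv.sub {Rr : S → S → S → Prop} {M N : ETm S} (h : EConv Rr M N)
    (σ : Nat → ETm S) : EConv Rr (M.sub σ) (N.sub σ) :=
  h.map (f := ETm.sub σ) (EStep.sub · σ)

theorem EConv.ren {Rr : S → S → S → Prop} {M N : ETm S} (h : EConv Rr M N)
    (ρ : Nat → Nat) : EConv Rr (M.ren ρ) (N.ren ρ) := by
  simpa only [ETm.ren_eq_sub] using h.sub fun n => .var (ρ n)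

/-- Parallel reduction of EPTS terms. -/
inductive EPar (Rr : S → S → S → Prop) : ETm S → ETm S → Prop
  | var {n} : EPar Rr (.var n) (.var n)
  | sort {s} : EPar Rr (.sort s) (.sort s)
  | pi {s₁ s₂ A A' B B'} : EPar Rr A A' → EPar Rr B B' →
      EPar Rr (.pi s₁ s₂ A B) (.pi s₁ s₂ A' B')
  | lam {s₁ s₂ A A' B B' M M'} : EPar Rr A A' → EPar Rr B B' → EPar Rr M M' →
      EPar Rr (.lam s₁ s₂ A B M) (.lam s₁ s₂ A' B' M')
  | app {s₁ s₂ A A' B B' M M' N N'} : EPar Rr A A' → EPar Rr B B' → EPar Rr M M' →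
      EPar Rr N N' → EPar Rr (.app s₁ s₂ A B M N) (.app s₁ s₂ A' B' M' N')
  | beta {s₁ s₂ s₃ A B A' B' M M' N N'} : Rr s₁ s₂ s₃ → EPar Rr M M' → EPar Rr N N' →
      EPar Rr (.app s₁ s₂ A B (.lam s₁ s₂ A' B' M) N) (ETm.substAt 0 N' M')

namespace EPar
variable {Rr : S → S → S → Prop}

theorem refl (M : ETm S) : EPar Rr M M := by
  induction M with
  | var => exact .var
  | sort => exact .sort
  | pi _ _ _ _ hA hB => exact .pi hA hB
  | lam _ _ _ _ _ hA hB hM => exact .lam hA hB hM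
  | app _ _ _ _ _ _ hA hB hM hN => exact .app hA hB hM hN

theorem of_step {M N : ETm S} (h : EStep Rr M N) : EPar Rr M N := by
  unfold EStep at h
  induction h with
  | base h =>
    obtain ⟨s₁, s₂, s₃, A, B, A', B', P, Q, hR, rfl, rfl⟩ := h
    exact .beta hR (refl P) (refl Q)
  | piA _ ih => exact .pi ih (refl _)
  | piB _ ih => exact .pi (refl _) ih
  | lamA _ ih => exact .lam ih (refl _) (refl _)
  | lamB _ ih => exact .lam (refl _) ih (refl _)
  | lamM _ ih => exact .lam (refl _) (refl _) ih
  | appA _ ih => exact .app ih (refl _) (refl _) (refl _)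
  | appB _ ih => exact .app (refl _) ih (refl _) (refl _)
  | appM _ ih => exact .app (refl _) (refl _) ih (refl _)
  | appN _ ih => exact .app (refl _) (refl _) (refl _) ih

theorem conv {M N : ETm S} (h : EPar Rr M N) : EConv Rr M N := by
  induction h with
  | var => exact .refl _
  | sort => exact .refl _
  | pi _ _ hA hB => exact .pi hA hB
  | lam _ _ _ hA hB hM => exact .lam hA hB hM
  | app _ _ _ _ hA hB hM hN => exact .app hA hB hM hN
  | beta hR _ _ hM hN =>
    exact (EConv.app (.refl _) (.refl _) (.lam (.refl _) (.refl _) hM) hN).trans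
      (.beta hR _ _ _ _ _ _)

theorem ren {M N : ETm S} (h : EPar Rr M N) (ρ : Nat → Nat) :
    EPar Rr (M.ren ρ) (N.ren ρ) := by
  induction h generalizing ρ with
  | var => exact .var
  | sort => exact .sort
  | pi _ _ hA hB => exact .pi (hA _) (hB _)
  | lam _ _ _ hA hB hM => exact .lam (hA _) (hB _) (hM _)
  | app _ _ _ _ hA hB hM hN => exact .app (hA _) (hB _) (hM _) (hN _)
  | beta hR _ _ hM hN => rw [ETm.ren_substAt]; exact .beta hR (hM _) (hN _)

theorem liftSub {σ τ : Nat → ETm S} (h : ∀ n, EPar Rr (σ n) (τ n)) (n : Nat) :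
    EPar Rr (ETm.liftSub σ n) (ETm.liftSub τ n) := by
  cases n with
  | zero => exact .var
  | succ n => exact (h n).ren _

theorem sub {M N : ETm S} (h : EPar Rr M N) {σ τ : Nat → ETm S}
    (hσ : ∀ n, EPar Rr (σ n) (τ n)) : EPar Rr (M.sub σ) (N.sub τ) := by
  induction h generalizing σ τ with
  | var => exact hσ _
  | sort => exact .sort
  | pi _ _ hA hB => exact .pi (hA hσ) (hB (liftSub hσ))
  | lam _ _ _ hA hB hM => exact .lam (hA hσ) (hB (liftSub hσ)) (hM (liftSub hσ))
  | app _ _ _ _ hA hB hM hN => exact .app (hA hσ) (hB (liftSub hσ)) (hM hσ) (hN hσ)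
  | beta hR _ _ hM hN =>
    rw [ETm.sub_substAt]; exact .beta hR (hM (liftSub hσ)) (hN hσ)

theorem substAt {M M' N N' : ETm S} (hM : EPar Rr M M') (hN : EPar Rr N N') :
    EPar Rr (ETm.substAt 0 N M) (ETm.substAt 0 N' M') := by
  rw [ETm.substAt_zero, ETm.substAt_zero]
  refine hM.sub fun n => ?_
  cases n with
  | zero => exact hN
  | succ n => exact .var

theorem diamond {M N N' : ETm S} (h : EPar Rr M N) (h' : EPar Rr M N') :
    ∃ P, EPar Rr N P ∧ EPar Rr N' P := by
  induction h generalizing N' with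
  | var => cases h'; exact ⟨_, .var, .var⟩
  | sort => cases h'; exact ⟨_, .sort, .sort⟩
  | pi _ _ ihA ihB =>
    cases h' with
    | pi hA hB =>
      obtain ⟨_, hA, hA'⟩ := ihA hA
      obtain ⟨_, hB, hB'⟩ := ihB hB
      exact ⟨_, .pi hA hB, .pi hA' hB'⟩
  | lam _ _ _ ihA ihB ihM =>
    cases h' with
    | lam hA hB hM =>
      obtain ⟨_, hA, hA'⟩ := ihA hA
      obtain ⟨_, hB, hB'⟩ := ihB hB
      obtain ⟨_, hM, hM'⟩ := ihM hM
      exact ⟨_, .lam hA hB hM, .lam hA' hB' hM'⟩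
  | app _ _ hM₁ _ ihA ihB ihM ihN =>
    cases h' with
    | app hA hB hM hN =>
      obtain ⟨_, hA, hA'⟩ := ihA hA
      obtain ⟨_, hB, hB'⟩ := ihB hB
      obtain ⟨_, hM, hM'⟩ := ihM hM
      obtain ⟨_, hN, hN'⟩ := ihN hN
      exact ⟨_, .app hA hB hM hN, .app hA' hB' hM' hN'⟩
    | beta hR hP hQ =>
      cases hM₁ with
      | lam =>
        obtain ⟨_, hM, hM'⟩ := ihM (.lam (refl _) (refl _) hP)
        obtain ⟨_, hN, hN'⟩ := ihN hQ
        cases hM with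
        | lam _ _ hM =>
          cases hM' with
          | lam _ _ hM' => exact ⟨_, .beta hR hM hN, hM'.substAt hN'⟩
  | beta hR _ _ ihM ihN =>
    cases h' with
    | app _ _ hM hN =>
      cases hM with
      | lam _ _ hM =>
        obtain ⟨_, hM, hM'⟩ := ihM hM
        obtain ⟨_, hN, hN'⟩ := ihN hN
        exact ⟨_, hM.substAt hN, .beta hR hM' hN'⟩
    | beta _ hM hN =>
      obtain ⟨_, hM, hM'⟩ := ihM hM
      obtain ⟨_, hN, hN'⟩ := ihN hN
      exact ⟨_, hM.substAt hN, hM'.substAt hN'⟩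

end EPar

open Relation in
theorem EConv.exists_common_reduct {Rr : S → S → S → Prop} {M N : ETm S} (h : EConv Rr M N) :
    ∃ P, ReflTransGen (EPar Rr) M P ∧ ReflTransGen (EPar Rr) N P := by
  have equiv : Equivalence (Join (ReflTransGen (EPar Rr))) :=
    equivalence_join_reflTransGen fun _ _ _ h h' =>
      let ⟨P, hP, hP'⟩ := h.diamond h'
      ⟨P, .single hP, .single hP'⟩
  induction h with
  | rel _ _ h => exact ⟨_, .single (.of_step h), .refl⟩
  | refl => exact equiv.refl _
  | symm _ _ _ ih => exact equiv.symm ih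
  | trans _ _ _ _ _ ih ih' => exact equiv.trans ih ih'

open Relation in
theorem eq_sort_of_reduces {Rr : S → S → S → Prop} {s : S} {M : ETm S}
    (h : ReflTransGen (EPar Rr) (.sort s) M) : M = .sort s := by
  induction h with
  | refl => rfl
  | tail _ h ih => subst ih; cases h; rfl

theorem EConv.sort_inj {Rr : S → S → S → Prop} {s s' : S}
    (h : EConv Rr (.sort s) (.sort s')) : s = s' := by
  obtain ⟨_, hP, hP'⟩ := h.exists_common_reduct
  simpa using (eq_sort_of_reduces hP).symm.trans (eq_sort_of_reduces hP')

open Relation in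
theorem exists_eq_pi_of_reduces {Rr : S → S → S → Prop} {s₁ s₂ : S} {A B M : ETm S}
    (h : ReflTransGen (EPar Rr) (.pi s₁ s₂ A B) M) :
    ∃ A' B', M = .pi s₁ s₂ A' B' ∧ EConv Rr A A' ∧ EConv Rr B B' := by
  induction h with
  | refl => exact ⟨A, B, rfl, .refl _, .refl _⟩
  | tail _ h ih =>
    obtain ⟨A', B', rfl, hA, hB⟩ := ih
    cases h with
    | pi hA' hB' => exact ⟨_, _, rfl, hA.trans hA'.conv, hB.trans hB'.conv⟩

theorem EConv.pi_inj {Rr : S → S → S → Prop} {s₁ s₂ t₁ t₂ : S} {A A' B B' : ETm S}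
    (h : EConv Rr (.pi s₁ s₂ A B) (.pi t₁ t₂ A' B')) : EConv Rr A A' ∧ EConv Rr B B' := by
  obtain ⟨_, hP, hP'⟩ := h.exists_common_reduct
  obtain ⟨_, _, rfl, hA, hB⟩ := exists_eq_pi_of_reduces hP
  obtain ⟨_, _, heq, hA', hB'⟩ := exists_eq_pi_of_reduces hP'
  cases heq
  exact ⟨hA.trans hA'.symm, hB.trans hB'.symm⟩

/-! ## Typing in an EPTS -/

namespace ETyped
variable {Ar : S → S → Prop} {Rr : S → S → S → Prop}

/-- Induction on typing derivations, ignoring the derivations of context well-formedness. -/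
@[elab_as_elim]
theorem induction_typed {P : ∀ Γ M A, ETyped Ar Rr Γ M A → Prop}
    (sort : ∀ {Γ s₁ s₂} (hΓ : EWf Ar Rr Γ) (h : Ar s₁ s₂), P Γ _ _ (.sort hΓ h))
    (var : ∀ {Γ n A} (hΓ : EWf Ar Rr Γ) (h : Γ[n]? = some A), P Γ _ _ (.var hΓ h))
    (conv : ∀ {Γ M A B s} (hM : ETyped Ar Rr Γ M A) (hB : ETyped Ar Rr Γ B (.sort s))
      (hAB : EConv Rr A B), P Γ M A hM → P Γ B _ hB → P Γ M B (.conv hM hB hAB))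
    (pi : ∀ {Γ s₁ s₂ s₃ A B} (hR : Rr s₁ s₂ s₃) (hA : ETyped Ar Rr Γ A (.sort s₁))
      (hB : ETyped Ar Rr (A :: Γ) B (.sort s₂)), P Γ A _ hA → P (A :: Γ) B _ hB →
      P Γ _ _ (.pi hR hA hB))
    (lam : ∀ {Γ s₁ s₂ s₃ A B M} (hR : Rr s₁ s₂ s₃) (hA : ETyped Ar Rr Γ A (.sort s₁))
      (hB : ETyped Ar Rr (A :: Γ) B (.sort s₂)) (hM : ETyped Ar Rr (A :: Γ) M B),
      P Γ A _ hA → P (A :: Γ) B _ hB → P (A :: Γ) M B hM → P Γ _ _ (.lam hR hA hB hM))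
    (app : ∀ {Γ s₁ s₂ s₃ A B M N} (hR : Rr s₁ s₂ s₃) (hA : ETyped Ar Rr Γ A (.sort s₁))
      (hB : ETyped Ar Rr (A :: Γ) B (.sort s₂)) (hN : ETyped Ar Rr Γ N A)
      (hM : ETyped Ar Rr Γ M (.pi s₁ s₂ A B)), P Γ A _ hA → P (A :: Γ) B _ hB → P Γ N A hN →
      P Γ M _ hM → P Γ _ _ (.app hR hA hB hN hM))
    {Γ : List (ETm S)} {M A : ETm S} (h : ETyped Ar Rr Γ M A) : P Γ M A h :=
  ETyped.rec (motive_1 := fun _ _ => True) (motive_2 := P)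
    trivial (fun _ _ => trivial) (fun hΓ h _ => sort hΓ h) (fun hΓ h _ => var hΓ h)
    conv pi lam app h

theorem wf {Γ : List (ETm S)} {M A : ETm S} (h : ETyped Ar Rr Γ M A) : EWf Ar Rr Γ := by
  induction h using induction_typed <;> assumption

/-- Well-typed renamings are admissible. -/
theorem ren {Γ : List (ETm S)} {M A : ETm S} (h : ETyped Ar Rr Γ M A) {Γ' : List (ETm S)}
    {ρ : Nat → Nat} (hΓ' : EWf Ar Rr Γ')
    (hρ : ∀ n A, Γ[n]? = some A → ∃ A', Γ'[ρ n]? = some A' ∧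
      A'.ren (· + (ρ n + 1)) = (A.ren (· + (n + 1))).ren ρ) :
    ETyped Ar Rr Γ' (M.ren ρ) (A.ren ρ) := by
  have lift {Γ Γ' : List (ETm S)} {ρ : Nat → Nat} (A : ETm S)
      (hρ : ∀ n A, Γ[n]? = some A → ∃ A', Γ'[ρ n]? = some A' ∧
        A'.ren (· + (ρ n + 1)) = (A.ren (· + (n + 1))).ren ρ) :
      ∀ n B, (A :: Γ)[n]? = some B →
        ∃ B', (A.ren ρ :: Γ')[Tm.liftRen ρ n]? = some B' ∧
          B'.ren (· + (Tm.liftRen ρ n + 1)) = (B.ren (· + (n + 1))).ren (Tm.liftRen ρ) := by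
    rintro (_ | n) B hB
    · obtain rfl : A = B := by simpa using hB
      exact ⟨A.ren ρ, by simp [Tm.liftRen], by simp [ETm.ren_ren, Tm.liftRen]⟩
    · obtain ⟨B', hB', heq⟩ := hρ n B (by simpa using hB)
      refine ⟨B', by simpa [Tm.liftRen] using hB', ?_⟩
      have := congrArg (ETm.ren Nat.succ) heq
      simpa [ETm.ren_ren, Tm.liftRen, Nat.succ_eq_add_one, add_assoc] using this
  induction h using induction_typed generalizing Γ' ρ with
  | sort _ h => exact .sort hΓ' h
  | var _ h =>
    obtain ⟨A', hA', heq⟩ := hρ _ _ h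
    rw [← heq]
    exact .var hΓ' hA'
  | conv _ _ hAB ihM ihB => exact .conv (ihM hΓ' hρ) (ihB hΓ' hρ) (hAB.ren ρ)
  | pi hR _ _ ihA ihB =>
    have hA := ihA hΓ' hρ
    exact .pi hR hA (ihB (.decl hA) (lift _ hρ))
  | lam hR _ _ _ ihA ihB ihM =>
    have hA := ihA hΓ' hρ
    exact .lam hR hA (ihB (.decl hA) (lift _ hρ)) (ihM (.decl hA) (lift _ hρ))
  | app hR _ _ _ _ ihA ihB ihN ihM =>
    have hA := ihA hΓ' hρ
    rw [ETm.ren_substAt]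
    exact .app hR hA (ihB (.decl hA) (lift _ hρ)) (ihN hΓ' hρ) (ihM hΓ' hρ)

theorem weaken {Γ : List (ETm S)} {M A B : ETm S} (h : ETyped Ar Rr Γ M A)
    (hΓ : EWf Ar Rr (B :: Γ)) : ETyped Ar Rr (B :: Γ) (M.ren Nat.succ) (A.ren Nat.succ) :=
  h.ren hΓ fun n A hA => ⟨A, by simpa using hA, by simp [ETm.ren_ren, add_assoc]⟩

/-- Well-typed substitutions are admissible. -/
theorem sub {Γ : List (ETm S)} {M A : ETm S} (h : ETyped Ar Rr Γ M A) {Γ' : List (ETm S)}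
    {σ : Nat → ETm S} (hΓ' : EWf Ar Rr Γ')
    (hσ : ∀ n A, Γ[n]? = some A → ETyped Ar Rr Γ' (σ n) ((A.ren (· + (n + 1))).sub σ)) :
    ETyped Ar Rr Γ' (M.sub σ) (A.sub σ) := by
  have lift {Γ Γ' : List (ETm S)} {σ : Nat → ETm S} (A : ETm S)
      (hΓ' : EWf Ar Rr (A.sub σ :: Γ'))
      (hσ : ∀ n A, Γ[n]? = some A → ETyped Ar Rr Γ' (σ n) ((A.ren (· + (n + 1))).sub σ)) :
      ∀ n B, (A :: Γ)[n]? = some B → ETyped Ar Rr (A.sub σ :: Γ') (ETm.liftSub σ n)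
        ((B.ren (· + (n + 1))).sub (ETm.liftSub σ)) := by
    rintro (_ | n) B hB
    · obtain rfl : A = B := by simpa using hB
      have := ETyped.var (n := 0) (A := A.sub σ) hΓ' (by simp)
      simpa [ETm.sub_ren, ETm.ren_sub] using this
    · have := (hσ n B (by simpa using hB)).weaken hΓ'
      simpa [ETm.sub_ren, ETm.ren_sub, ← add_assoc] using this
  induction h using induction_typed generalizing Γ' σ with
  | sort _ h => exact .sort hΓ' h
  | var _ h => exact hσ _ _ h
  | conv _ _ hAB ihM ihB => exact .conv (ihM hΓ' hσ) (ihB hΓ' hσ) (hAB.sub σ)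
  | pi hR _ _ ihA ihB =>
    have hA := ihA hΓ' hσ
    exact .pi hR hA (ihB (.decl hA) (lift _ (.decl hA) hσ))
  | lam hR _ _ _ ihA ihB ihM =>
    have hA := ihA hΓ' hσ
    exact .lam hR hA (ihB (.decl hA) (lift _ (.decl hA) hσ))
      (ihM (.decl hA) (lift _ (.decl hA) hσ))
  | app hR _ _ _ _ ihA ihB ihN ihM =>
    have hA := ihA hΓ' hσ
    rw [ETm.sub_substAt]
    exact .app hR hA (ihB (.decl hA) (lift _ (.decl hA) hσ)) (ihN hΓ' hσ) (ihM hΓ' hσ)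

theorem substAt {Γ : List (ETm S)} {M N A B : ETm S} (hM : ETyped Ar Rr (A :: Γ) M B)
    (hN : ETyped Ar Rr Γ N A) :
    ETyped Ar Rr Γ (ETm.substAt 0 N M) (ETm.substAt 0 N B) := by
  rw [ETm.substAt_zero, ETm.substAt_zero]
  refine hM.sub hN.wf ?_
  rintro (_ | n) A' hA'
  · obtain rfl : A = A' := by simpa using hA'
    simpa [ETm.sub_ren] using hN
  · have := ETyped.var (Ar := Ar) (Rr := Rr) (n := n) (A := A') hN.wf (by simpa using hA')
    rw [ETm.ren_eq_sub] at this
    simpa [ETm.sub_ren, ← add_assoc] using this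

theorem ctx_conv {Γ : List (ETm S)} {M A A' B : ETm S} {s s' : S}
    (h : ETyped Ar Rr (A :: Γ) M B) (hA : ETyped Ar Rr Γ A (.sort s))
    (hA' : ETyped Ar Rr Γ A' (.sort s')) (hconv : EConv Rr A A') :
    ETyped Ar Rr (A' :: Γ) M B := by
  have hΓ : EWf Ar Rr (A' :: Γ) := .decl hA'
  suffices ETyped Ar Rr (A' :: Γ) (M.sub .var) (B.sub .var) by simpa using this
  refine h.sub hΓ ?_
  rintro (_ | n) C hC
  · obtain rfl : A = C := by simpa using hC
    have := ETyped.var (Ar := Ar) (Rr := Rr) (n := 0) (A := A') hΓ (by simp)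
    simpa using this.conv (hA.weaken hΓ) (hconv.symm.ren _)
  · simpa using ETyped.var (Ar := Ar) (Rr := Rr) (n := n + 1) (A := C) hΓ (by simpa using hC)

theorem sort_inv {Γ : List (ETm S)} {s : S} {T : ETm S} (h : ETyped Ar Rr Γ (.sort s) T) :
    ∃ s', Ar s s' ∧ EConv Rr (.sort s') T := by
  generalize hM : ETm.sort s = M at h
  induction h using induction_typed with
  | sort _ h => cases hM; exact ⟨_, h, .refl _⟩
  | conv _ _ hAB ih =>
    obtain ⟨s', h, h'⟩ := ih hM
    exact ⟨s', h, h'.trans hAB⟩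
  | _ => cases hM

theorem var_inv {Γ : List (ETm S)} {n : Nat} {T : ETm S} (h : ETyped Ar Rr Γ (.var n) T) :
    ∃ A, Γ[n]? = some A ∧ EConv Rr (A.ren (· + (n + 1))) T := by
  generalize hM : ETm.var n = M at h
  induction h using induction_typed with
  | var _ h => cases hM; exact ⟨_, h, .refl _⟩
  | conv _ _ hAB ih =>
    obtain ⟨A, h, h'⟩ := ih hM
    exact ⟨A, h, h'.trans hAB⟩
  | _ => cases hM

theorem pi_inv {Γ : List (ETm S)} {s₁ s₂ : S} {A B T : ETm S}
    (h : ETyped Ar Rr Γ (.pi s₁ s₂ A B) T) : ∃ s₃, Rr s₁ s₂ s₃ ∧ EConv Rr (.sort s₃) T := by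
  generalize hM : ETm.pi s₁ s₂ A B = M at h
  induction h using induction_typed with
  | pi hR => cases hM; exact ⟨_, hR, .refl _⟩
  | conv _ _ hAB ih =>
    obtain ⟨s₃, h, h'⟩ := ih hM
    exact ⟨s₃, h, h'.trans hAB⟩
  | _ => cases hM

theorem lam_inv {Γ : List (ETm S)} {s₁ s₂ : S} {A B M T : ETm S}
    (h : ETyped Ar Rr Γ (.lam s₁ s₂ A B M) T) :
    ETyped Ar Rr Γ A (.sort s₁) ∧ ETyped Ar Rr (A :: Γ) B (.sort s₂) ∧
      ETyped Ar Rr (A :: Γ) M B ∧ EConv Rr (.pi s₁ s₂ A B) T := by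
  generalize hM : ETm.lam s₁ s₂ A B M = L at h
  induction h using induction_typed with
  | lam _ hA hB hM' => cases hM; exact ⟨hA, hB, hM', .refl _⟩
  | conv _ _ hAB ih =>
    obtain ⟨hA, hB, hM', h⟩ := ih hM
    exact ⟨hA, hB, hM', h.trans hAB⟩
  | _ => cases hM

theorem app_inv {Γ : List (ETm S)} {s₁ s₂ : S} {A B M N T : ETm S}
    (h : ETyped Ar Rr Γ (.app s₁ s₂ A B M N) T) : EConv Rr (ETm.substAt 0 N B) T := by
  generalize hM : ETm.app s₁ s₂ A B M N = L at h
  induction h using induction_typed with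
  | app => cases hM; exact .refl _
  | conv _ _ hAB ih => exact (ih hM).trans hAB
  | _ => cases hM

theorem not_isTopSort {Γ : List (ETm S)} {s : S} {T : ETm S}
    (h : ETyped Ar Rr Γ (.sort s) T) : ¬ IsTopSort Ar s :=
  let ⟨t, ht, _⟩ := h.sort_inv
  fun htop => htop ⟨t, ht⟩

/-- Uniqueness of types up to conversion. -/
theorem unique (hfun : FunctionalSpec Ar Rr) {Γ : List (ETm S)} {M A B : ETm S}
    (h : ETyped Ar Rr Γ M A) (h' : ETyped Ar Rr Γ M B) : EConv Rr A B := by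
  induction h using induction_typed with
  | sort _ h =>
    obtain ⟨s, hs, hconv⟩ := h'.sort_inv
    exact hfun.1 _ _ _ hs h ▸ hconv
  | var _ h =>
    obtain ⟨A', hA', hconv⟩ := h'.var_inv
    cases h.symm.trans hA'
    exact hconv
  | conv _ _ hAB ih => exact hAB.symm.trans (ih h')
  | pi hR =>
    obtain ⟨s, hs, hconv⟩ := h'.pi_inv
    exact hfun.2 _ _ _ _ hs hR ▸ hconv
  | lam => exact h'.lam_inv.2.2.2
  | app => exact h'.app_inv

theorem unique_sort (hfun : FunctionalSpec Ar Rr) {Γ : List (ETm S)} {A : ETm S} {s s' : S}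
    (h : ETyped Ar Rr Γ A (.sort s)) (h' : ETyped Ar Rr Γ A (.sort s')) : s = s' :=
  (h.unique hfun h').sort_inj

/-- Subject reduction. -/
theorem par {Γ : List (ETm S)} {M M' A : ETm S} (h : ETyped Ar Rr Γ M A)
    (hpar : EPar Rr M M') : ETyped Ar Rr Γ M' A := by
  induction h using induction_typed generalizing M' with
  | sort hΓ h => cases hpar; exact .sort hΓ h
  | var hΓ h => cases hpar; exact .var hΓ h
  | conv _ hB hAB ih => exact .conv (ih hpar) hB hAB
  | pi hR hA _ ihA ihB =>
    cases hpar with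
    | pi hA' hB' => exact .pi hR (ihA hA') ((ihB hB').ctx_conv hA (ihA hA') hA'.conv)
  | lam hR hA hB _ ihA ihB ihM =>
    cases hpar with
    | lam hA' hB' hM' =>
      have hM₁ := (ihM hM').conv (ihB hB') hB'.conv
      exact .conv (.lam hR (ihA hA') ((ihB hB').ctx_conv hA (ihA hA') hA'.conv)
        (hM₁.ctx_conv hA (ihA hA') hA'.conv)) (.pi hR hA hB) (.symm (.pi hA'.conv hB'.conv))
  | app hR hA hB hN _ ihA ihB ihN ihM =>
    have hT := hB.substAt hN
    cases hpar with
    | app hA' hB' hM' hN' =>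
      have hB₁ := (ihB hB').ctx_conv hA (ihA hA') hA'.conv
      refine .conv (.app hR (ihA hA') hB₁ ((ihN hN').conv (ihA hA') hA'.conv)
        ((ihM hM').conv (.pi hR (ihA hA') hB₁) (.pi hA'.conv hB'.conv))) hT ?_
      exact (hB'.substAt hN').conv.symm
    | beta _ hP hN' =>
      obtain ⟨hA₁, hB₁, hP₁, hconv⟩ := (ihM (.lam (.refl _) (.refl _) hP)).lam_inv
      obtain ⟨hconvA, hconvB⟩ := hconv.pi_inj
      refine .conv (hP₁.substAt ((ihN hN').conv hA₁ hconvA.symm)) hT ?_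
      refine .trans ?_ ((EPar.refl _).substAt hN').conv.symm
      simpa only [ETm.substAt_zero] using hconvB.sub _

theorem reduces {Γ : List (ETm S)} {M M' A : ETm S} (h : ETyped Ar Rr Γ M A)
    (hred : Relation.ReflTransGen (EPar Rr) M M') : ETyped Ar Rr Γ M' A := by
  induction hred with
  | refl => exact h
  | tail _ hpar ih => exact ih.par hpar

theorem sort_eq_of_conv (hfun : FunctionalSpec Ar Rr) {Γ : List (ETm S)} {A B : ETm S}
    {s s' : S} (hA : ETyped Ar Rr Γ A (.sort s)) (hB : ETyped Ar Rr Γ B (.sort s'))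
    (hconv : EConv Rr A B) : s = s' :=
  let ⟨_, hA', hB'⟩ := hconv.exists_common_reduct
  (hA.reduces hA').unique_sort hfun (hB.reduces hB')

theorem sort_of_conv {Γ : List (ETm S)} {A T : ETm S} {s : S} (hA : ETyped Ar Rr Γ A T)
    (hconv : EConv Rr (.sort s) A) : ETyped Ar Rr Γ (.sort s) T := by
  obtain ⟨_, hs, hA'⟩ := hconv.exists_common_reduct
  exact eq_sort_of_reduces hs ▸ hA.reduces hA'

end ETyped

theorem EWf.typed_of_getElem? {Ar : S → S → Prop} {Rr : S → S → S → Prop} {Γ : List (ETm S)}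
    (hΓ : EWf Ar Rr Γ) {n : Nat} {A : ETm S} (h : Γ[n]? = some A) :
    ∃ s, ETyped Ar Rr Γ (A.ren (· + (n + 1))) (.sort s) := by
  induction Γ generalizing n A with
  | nil => simp at h
  | cons B Γ ih =>
    have hΓ₀ := hΓ
    cases hΓ with
    | decl hB =>
      cases n with
      | zero =>
        obtain rfl : B = A := by simpa using h
        exact ⟨_, hB.weaken hΓ₀⟩
      | succ n =>
        obtain ⟨s, hs⟩ := ih hB.wf (by simpa using h)
        refine ⟨s, ?_⟩
        simpa [ETm.ren_ren, ETm.ren, add_assoc] using hs.weaken hΓ₀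

/-- Every type is a top-sort or has a sort as type. -/
theorem ETyped.isTopSort_or_typed {Ar : S → S → Prop} {Rr : S → S → S → Prop}
    {Γ : List (ETm S)} {M A : ETm S} (h : ETyped Ar Rr Γ M A) :
    (∃ s, A = .sort s ∧ IsTopSort Ar s) ∨ ∃ s, ETyped Ar Rr Γ A (.sort s) := by
  have of_sort {Γ : List (ETm S)} (hΓ : EWf Ar Rr Γ) (s : S) :
      (∃ s', ETm.sort s = .sort s' ∧ IsTopSort Ar s') ∨
        ∃ s', ETyped Ar Rr Γ (.sort s) (.sort s') := by
    by_cases hs : IsTopSort Ar s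
    · exact .inl ⟨s, rfl, hs⟩
    · obtain ⟨s', hs'⟩ := not_not.mp hs
      exact .inr ⟨s', .sort hΓ hs'⟩
  cases h with
  | sort hΓ _ => exact of_sort hΓ _
  | var hΓ h => exact .inr (hΓ.typed_of_getElem? h)
  | conv _ hB _ => exact .inr ⟨_, hB⟩
  | pi _ hA _ => exact of_sort hA.wf _
  | lam hR hA hB _ => exact .inr ⟨_, .pi hR hA hB⟩
  | app _ _ hB hN _ => exact .inr ⟨_, hB.substAt hN⟩

/-! ## Conversion in Dedukti -/

namespace Conv
variable {R : Rules C}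

theorem refl (M : Tm C) : Conv R M M := Relation.EqvGen.refl M

theorem symm {M N : Tm C} (h : Conv R M N) : Conv R N M := Relation.EqvGen.symm _ _ h

theorem trans {M N P : Tm C} (h : Conv R M N) (h' : Conv R N P) : Conv R M P :=
  Relation.EqvGen.trans _ _ _ h h'

theorem map {f : Tm C → Tm C} (hf : ∀ {M N}, Step R M N → Step R (f M) (f N))
    {M N : Tm C} (h : Conv R M N) : Conv R (f M) (f N) := by
  induction h with
  | rel _ _ h => exact .rel _ _ (hf h)
  | refl => exact .refl _
  | symm _ _ _ ih => exact ih.symm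
  | trans _ _ _ _ _ ih ih' => exact ih.trans ih'

theorem lam {A A' M M' : Tm C} (hA : Conv R A A') (hM : Conv R M M') :
    Conv R (.lam A M) (.lam A' M') :=
  (hA.map (f := (.lam · M)) .lamA).trans (hM.map (f := (.lam A' ·)) .lamM)

theorem const {c : C} {Ms Ms' : List (Tm C)} (h : List.Forall₂ (Conv R) Ms Ms') :
    Conv R (.const c Ms) (.const c Ms') := by
  suffices ∀ l : List (Tm C), Conv R (.const c (l ++ Ms)) (.const c (l ++ Ms')) from this []
  induction h with
  | nil => exact fun _ => .refl _
  | @cons M M' Ms Ms' hM _ ih =>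
    intro l
    refine (hM.map (f := fun M => .const c (l ++ M :: Ms)) .constArg).trans ?_
    simpa using ih (l ++ [M'])

theorem beta (A M N : Tm C) : Conv R (.app (.lam A M) N) (Tm.substAt 0 N M) :=
  .rel _ _ (.base (.inl ⟨A, M, N, rfl, rfl⟩))

end Conv

theorem Step.sub {R : Rules C} {M N : Tm C} (h : Step R M N) (σ : Nat → Tm C) :
    Step R (M.sub σ) (N.sub σ) := by
  unfold Step at *
  induction h generalizing σ with
  | base h =>
    refine .base ?_
    rcases h with ⟨A, P, Q, rfl, rfl⟩ | ⟨rl, hrl, τ, rfl, rfl⟩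
    · exact .inl ⟨A.sub σ, _, _, by simp only [Tm.sub_app, Tm.sub_lam], Tm.sub_substAt σ Q P⟩
    · exact .inr ⟨rl, hrl, _, Tm.sub_sub τ σ _, Tm.sub_sub τ σ _⟩
  | appL _ ih => simpa using .appL (ih σ)
  | appR _ ih => simpa using .appR (ih σ)
  | lamA _ ih => simpa using .lamA (ih σ)
  | lamM _ ih => simpa using .lamM (ih _)
  | piA _ ih => simpa using .piA (ih σ)
  | piB _ ih => simpa using .piB (ih _)
  | constArg _ ih => simpa using .constArg (ih σ)

theorem Conv.sub {R : Rules C} {M N : Tm C} (h : Conv R M N) (σ : Nat → Tm C) :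
    Conv R (M.sub σ) (N.sub σ) :=
  h.map (f := Tm.sub σ) (Step.sub · σ)

/-! ## Typing stable under substitution -/

/-- `σ` is a substitution from `Δ` to `Δ'`, well-typed in every well-formed extension
of `Δ'`. -/
def ValidSub (Sg : Sig C) (R : Rules C) (Δ : List (Tm C)) (σ : Nat → Tm C)
    (Δ' : List (Tm C)) : Prop :=
  Wf Sg R Δ' ∧ ∀ n A, Δ[n]? = some A → ∀ Θ, Wf Sg R (Θ ++ Δ') →
    Typed Sg R (Θ ++ Δ') ((σ n).ren (· + Θ.length))
      (((A.ren (· + (n + 1))).sub σ).ren (· + Θ.length))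

/-- `M` has type `A` in `Δ` after any valid substitution. -/
def StableTyped (Sg : Sig C) (R : Rules C) (Δ : List (Tm C)) (M A : Tm C) : Prop :=
  ∀ σ Δ', ValidSub Sg R Δ σ Δ' → Typed Sg R Δ' (M.sub σ) (A.sub σ)

section
variable {Sg : Sig C} {R : Rules C}

theorem Typed.var_zero {Γ : List (Tm C)} {A : Tm C} (h : Wf Sg R (A :: Γ)) :
    Typed Sg R (A :: Γ) (.var 0) (A.ren Nat.succ) :=
  .var (n := 0) h rfl

namespace ValidSub

theorem id {Δ : List (Tm C)} (h : Wf Sg R Δ) : ValidSub Sg R Δ .var Δ := by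
  refine ⟨h, fun n A hA Θ hΘ => ?_⟩
  have := Typed.var (n := n + Θ.length) (A := A) hΘ (by simpa [List.getElem?_append] using hA)
  simpa [Tm.ren_ren, add_assoc, add_comm, add_left_comm] using this

theorem weaken {Δ Δ' : List (Tm C)} {σ : Nat → Tm C} (h : ValidSub Sg R Δ σ Δ')
    {Θ : List (Tm C)} (hΘ : Wf Sg R (Θ ++ Δ')) :
    ValidSub Sg R Δ (fun n => (σ n).ren (· + Θ.length)) (Θ ++ Δ') := by
  refine ⟨hΘ, fun n A hA Θ' hΘ' => ?_⟩
  have := h.2 n A hA (Θ' ++ Θ) (by simpa using hΘ')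
  simpa [Tm.ren_ren, Tm.ren_sub, add_assoc, add_comm, add_left_comm] using this

theorem tail {Δ Δ' : List (Tm C)} {σ : Nat → Tm C} {A : Tm C}
    (h : ValidSub Sg R (A :: Δ) σ Δ') : ValidSub Sg R Δ (fun n => σ (n + 1)) Δ' := by
  refine ⟨h.1, fun n B hB Θ hΘ => ?_⟩
  have := h.2 (n + 1) B (by simpa using hB) Θ hΘ
  simpa [Tm.sub_ren, ← add_assoc] using this

theorem lift {Δ Δ' : List (Tm C)} {σ : Nat → Tm C} {A : Tm C} (h : ValidSub Sg R Δ σ Δ')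
    (hA : Typed Sg R Δ' (A.sub σ) .type) :
    ValidSub Sg R (A :: Δ) (Tm.liftSub σ) (A.sub σ :: Δ') := by
  refine ⟨.decl hA, ?_⟩
  rintro (_ | n) B hB Θ hΘ
  · obtain rfl : A = B := by simpa using hB
    have := Typed.var (n := Θ.length) (A := A.sub σ) hΘ (by simp)
    simpa [Tm.ren_ren, Tm.sub_ren, Tm.ren_sub, add_assoc, add_comm, add_left_comm] using this
  · have := h.2 n B (by simpa using hB) (Θ ++ [A.sub σ]) (by simpa using hΘ)
    simpa [Tm.ren_ren, Tm.sub_ren, Tm.ren_sub, ← add_assoc, add_right_comm] using this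

theorem scons {Δ Δ' : List (Tm C)} {σ : Nat → Tm C} {N A : Tm C} (h : ValidSub Sg R Δ σ Δ')
    (hN : StableTyped Sg R Δ N A) : ValidSub Sg R (A :: Δ) (scons (N.sub σ) σ) Δ' := by
  refine ⟨h.1, ?_⟩
  rintro (_ | n) B hB Θ hΘ
  · obtain rfl : A = B := by simpa using hB
    have := hN _ _ (h.weaken hΘ)
    simpa [Tm.sub_ren, Tm.ren_sub] using this
  · have := h.2 n B (by simpa using hB) Θ hΘ
    simpa [Tm.sub_ren, ← add_assoc] using this

end ValidSub

namespace StableTyped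

theorem typed {Δ : List (Tm C)} {M A : Tm C} (h : StableTyped Sg R Δ M A) (hΔ : Wf Sg R Δ) :
    Typed Sg R Δ M A := by
  simpa using h _ _ (.id hΔ)

theorem var {Δ : List (Tm C)} {n : Nat} {A : Tm C} (h : Δ[n]? = some A) :
    StableTyped Sg R Δ (.var n) (A.ren (· + (n + 1))) := by
  intro σ Δ' hσ
  simpa using hσ.2 n A h [] hσ.1

theorem weaken {Δ : List (Tm C)} {M A : Tm C} (h : StableTyped Sg R Δ M A) (B : Tm C) :
    StableTyped Sg R (B :: Δ) (M.ren Nat.succ) (A.ren Nat.succ) := by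
  intro σ Δ' hσ
  simpa [Tm.sub_ren] using h _ _ hσ.tail

theorem substAt {Δ : List (Tm C)} {M N A B : Tm C} (hM : StableTyped Sg R (A :: Δ) M B)
    (hN : StableTyped Sg R Δ N A) :
    StableTyped Sg R Δ (Tm.substAt 0 N M) (Tm.substAt 0 N B) := by
  intro σ Δ' hσ
  simpa only [Tm.sub_substAt_zero] using hM _ _ (hσ.scons hN)

theorem conv {Δ : List (Tm C)} {M A B : Tm C} (hM : StableTyped Sg R Δ M A)
    (hB : StableTyped Sg R Δ B .type) (hAB : Conv R A B) : StableTyped Sg R Δ M B :=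
  fun σ _ hσ => .conv (hM _ _ hσ) (by simpa using hB _ _ hσ) (.inl rfl) (hAB.sub σ)

theorem lam {Δ : List (Tm C)} {A B M : Tm C} (hA : StableTyped Sg R Δ A .type)
    (hB : StableTyped Sg R (A :: Δ) B .type) (hM : StableTyped Sg R (A :: Δ) M B) :
    StableTyped Sg R Δ (.lam A M) (.pi A B) := by
  intro σ Δ' hσ
  have hA' : Typed Sg R Δ' (A.sub σ) .type := by simpa using hA _ _ hσ
  simpa using Typed.abs hA' (by simpa using hB _ _ (hσ.lift hA')) (.inl rfl)
    (hM _ _ (hσ.lift hA'))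

theorem app {Δ : List (Tm C)} {A B M N : Tm C} (hM : StableTyped Sg R Δ M (.pi A B))
    (hN : StableTyped Sg R Δ N A) :
    StableTyped Sg R Δ (.app M N) (Tm.substAt 0 N B) := by
  intro σ Δ' hσ
  rw [Tm.sub_app, Tm.sub_substAt]
  exact .app (by simpa using hM _ _ hσ) (hN _ _ hσ)

end StableTyped
end

/-! ## Typing rules of the encoding -/

section
variable (σ : Nat → Tm (EConst S))

@[simp] theorem sub_Ucon (s : S) : (Ucon s).sub σ = Ucon s := by simp [Ucon]

@[simp] theorem sub_ucon (s : S) : (ucon s).sub σ = ucon s := by simp [ucon]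

@[simp] theorem sub_Elcon (s : S) (A : Tm (EConst S)) :
    (Elcon s A).sub σ = Elcon s (A.sub σ) := by simp [Elcon]

@[simp] theorem sub_ProdC (s₁ s₂ : S) (A B : Tm (EConst S)) :
    (ProdC s₁ s₂ A B).sub σ = ProdC s₁ s₂ (A.sub σ) (B.sub σ) := by simp [ProdC]

@[simp] theorem sub_absC (s₁ s₂ : S) (A B M : Tm (EConst S)) :
    (absC s₁ s₂ A B M).sub σ = absC s₁ s₂ (A.sub σ) (B.sub σ) (M.sub σ) := by simp [absC]

@[simp] theorem sub_appC (s₁ s₂ : S) (A B M N : Tm (EConst S)) :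
    (appC s₁ s₂ A B M N).sub σ = appC s₁ s₂ (A.sub σ) (B.sub σ) (M.sub σ) (N.sub σ) := by
  simp [appC]

@[simp] theorem ren_Ucon (ρ : Nat → Nat) (s : S) : (Ucon s).ren ρ = Ucon s := by
  simp [Ucon]

@[simp] theorem ren_Elcon (ρ : Nat → Nat) (s : S) (A : Tm (EConst S)) :
    (Elcon s A).ren ρ = Elcon s (A.ren ρ) := by simp [Elcon]

end

namespace Typed
variable {Ar : S → S → Prop} {Rr : S → S → S → Prop} {Γ : List (Tm (EConst S))}

theorem univ (s : S) : Typed (sigEPTS Ar Rr) (rulesEPTS Ar Rr) Γ (Ucon s) .type := by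
  simpa [instArgs, Ucon] using Typed.cons (S := sigEPTS Ar Rr) (Γ := Γ) (SigEPTSMem.U s) (.sort .empty) (.inr rfl) .nil

theorem el {s : S} {A : Tm (EConst S)}
    (hA : Typed (sigEPTS Ar Rr) (rulesEPTS Ar Rr) Γ A (Ucon s)) :
    Typed (sigEPTS Ar Rr) (rulesEPTS Ar Rr) Γ (Elcon s A) .type := by
  simpa [instArgs, Elcon] using Typed.cons (S := sigEPTS Ar Rr) (SigEPTSMem.El s) (.sort (.decl (univ s))) (.inr rfl)
    (.cons hA .nil)

theorem univCode {s₁ s₂ : S} (h : Ar s₁ s₂) :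
    Typed (sigEPTS Ar Rr) (rulesEPTS Ar Rr) Γ (ucon s₁) (Ucon s₂) := by
  simpa [instArgs, ucon] using Typed.cons (S := sigEPTS Ar Rr) (Γ := Γ) (SigEPTSMem.u h) (univ s₂) (.inl rfl) .nil

theorem prodCode {s₁ s₂ s₃ : S} (hR : Rr s₁ s₂ s₃) {A B : Tm (EConst S)}
    (hA : Typed (sigEPTS Ar Rr) (rulesEPTS Ar Rr) Γ A (Ucon s₁))
    (hB : Typed (sigEPTS Ar Rr) (rulesEPTS Ar Rr) Γ B (.pi (Elcon s₁ A) (Ucon s₂))) :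
    Typed (sigEPTS Ar Rr) (rulesEPTS Ar Rr) Γ (ProdC s₁ s₂ A B) (Ucon s₃) := by
  simpa [instArgs, ProdC] using Typed.cons (S := sigEPTS Ar Rr) (SigEPTSMem.Prod hR) (univ s₃) (.inl rfl)
    (.cons hA (.cons (by simpa [Tm.substAt] using hB) .nil))

theorem pi_Ucon {s₁ s₂ : S} {A : Tm (EConst S)}
    (hA : Typed (sigEPTS Ar Rr) (rulesEPTS Ar Rr) Γ A (Ucon s₁)) :
    Typed (sigEPTS Ar Rr) (rulesEPTS Ar Rr) Γ (.pi (Elcon s₁ A) (Ucon s₂)) .type :=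
  .prod (el hA) (univ s₂) (.inl rfl)

theorem wf_Prod_telescope (s₁ s₂ : S) : Wf (sigEPTS Ar Rr) (rulesEPTS Ar Rr)
    [.pi (Elcon s₁ (.var 0)) (Ucon s₂), Ucon s₁] :=
  .decl (pi_Ucon (by simpa using Typed.var_zero (.decl (univ s₁))))

theorem absCode {s₁ s₂ s₃ : S} (hR : Rr s₁ s₂ s₃) {A B M : Tm (EConst S)}
    (hA : Typed (sigEPTS Ar Rr) (rulesEPTS Ar Rr) Γ A (Ucon s₁))
    (hB : Typed (sigEPTS Ar Rr) (rulesEPTS Ar Rr) Γ B (.pi (Elcon s₁ A) (Ucon s₂)))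
    (hM : Typed (sigEPTS Ar Rr) (rulesEPTS Ar Rr) Γ M
      (.pi (Elcon s₁ A) (Elcon s₂ (.app (B.ren Nat.succ) (.var 0))))) :
    Typed (sigEPTS Ar Rr) (rulesEPTS Ar Rr) Γ (absC s₁ s₂ A B M)
      (Elcon s₃ (ProdC s₁ s₂ A B)) := by
  have hΔ : Wf (sigEPTS Ar Rr) (rulesEPTS Ar Rr)
      [.pi (Elcon s₁ (.var 1)) (Elcon s₂ (.app (.var 1) (.var 0))),
        .pi (Elcon s₁ (.var 0)) (Ucon s₂), Ucon s₁] := by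
    have hA₂ : Typed (sigEPTS Ar Rr) (rulesEPTS Ar Rr)
        [.pi (Elcon s₁ (.var 0)) (Ucon s₂), Ucon s₁] (.var 1) (Ucon s₁) := by
      simpa using Typed.var (n := 1) (wf_Prod_telescope s₁ s₂) rfl
    have hΔ₃ := Wf.decl (el hA₂)
    refine .decl (.prod (el hA₂) (el ?_) (.inl rfl))
    have hB₃ := Typed.var (n := 1) hΔ₃ rfl
    have hx := Typed.var (n := 0) hΔ₃ rfl
    simp at hB₃ hx
    simpa [Tm.substAt] using Typed.app hB₃ hx
  have hA₃ := Typed.var (n := 2) hΔ rfl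
  have hB₃ := Typed.var (n := 1) hΔ rfl
  simp at hA₃ hB₃
  have := Typed.cons (S := sigEPTS Ar Rr) (SigEPTSMem.abs hR) (el (prodCode hR hA₃ hB₃)) (.inl rfl)
    (.cons hA (.cons (by simpa [Tm.substAt] using hB) (.cons (A := _) (M := M) ?_ .nil)))
  · simpa [instArgs, absC] using this
  · simpa [Tm.substAt, Tm.sub_ren, Tm.liftSub] using hM

theorem appCode {s₁ s₂ s₃ : S} (hR : Rr s₁ s₂ s₃) {A B M N : Tm (EConst S)}
    (hA : Typed (sigEPTS Ar Rr) (rulesEPTS Ar Rr) Γ A (Ucon s₁))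
    (hB : Typed (sigEPTS Ar Rr) (rulesEPTS Ar Rr) Γ B (.pi (Elcon s₁ A) (Ucon s₂)))
    (hM : Typed (sigEPTS Ar Rr) (rulesEPTS Ar Rr) Γ M (Elcon s₃ (ProdC s₁ s₂ A B)))
    (hN : Typed (sigEPTS Ar Rr) (rulesEPTS Ar Rr) Γ N (Elcon s₁ A)) :
    Typed (sigEPTS Ar Rr) (rulesEPTS Ar Rr) Γ (appC s₁ s₂ A B M N)
      (Elcon s₂ (.app B N)) := by
  have hΔ : Wf (sigEPTS Ar Rr) (rulesEPTS Ar Rr)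
      [Elcon s₁ (.var 2), Elcon s₃ (ProdC s₁ s₂ (.var 1) (.var 0)),
        .pi (Elcon s₁ (.var 0)) (Ucon s₂), Ucon s₁] := by
    have hΔ₂ := wf_Prod_telescope (Ar := Ar) (Rr := Rr) s₁ s₂
    have hA₂ := Typed.var (n := 1) hΔ₂ rfl
    have hB₂ := Typed.var (n := 0) hΔ₂ rfl
    simp at hA₂ hB₂
    have hA₃ := Typed.var (n := 2) (.decl (el (prodCode hR hA₂ hB₂))) rfl
    simp at hA₃
    exact .decl (el hA₃)
  have hB₄ := Typed.var (n := 2) hΔ rfl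
  have hN₄ := Typed.var (n := 0) hΔ rfl
  simp at hB₄ hN₄
  have hT := Typed.app hB₄ hN₄
  simp [Tm.substAt] at hT
  have := Typed.cons (S := sigEPTS Ar Rr) (SigEPTSMem.app hR) (el hT) (.inl rfl)
    (.cons hA (.cons (by simpa [Tm.substAt] using hB)
      (.cons (A := _) (M := M) ?_ (.cons (A := _) (M := N) ?_ .nil))))
  · simpa [instArgs, appC] using this
  · simpa [Tm.substAt, Tm.sub_ren] using hM
  · simpa [Tm.substAt, Tm.sub_ren, Tm.sub_sub] using hN

end Typed

namespace StableTyped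
variable {Ar : S → S → Prop} {Rr : S → S → S → Prop} {Δ : List (Tm (EConst S))}

theorem univ (s : S) : StableTyped (sigEPTS Ar Rr) (rulesEPTS Ar Rr) Δ (Ucon s) .type :=
  fun σ _ _ => by simpa using Typed.univ s

theorem el {s : S} {A : Tm (EConst S)}
    (hA : StableTyped (sigEPTS Ar Rr) (rulesEPTS Ar Rr) Δ A (Ucon s)) :
    StableTyped (sigEPTS Ar Rr) (rulesEPTS Ar Rr) Δ (Elcon s A) .type :=
  fun σ _ hσ => by simpa using Typed.el (by simpa using hA _ _ hσ)

theorem univCode {s₁ s₂ : S} (h : Ar s₁ s₂) :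
    StableTyped (sigEPTS Ar Rr) (rulesEPTS Ar Rr) Δ (ucon s₁) (Ucon s₂) :=
  fun σ _ _ => by simpa using Typed.univCode h

theorem prodCode {s₁ s₂ s₃ : S} (hR : Rr s₁ s₂ s₃) {A B : Tm (EConst S)}
    (hA : StableTyped (sigEPTS Ar Rr) (rulesEPTS Ar Rr) Δ A (Ucon s₁))
    (hB : StableTyped (sigEPTS Ar Rr) (rulesEPTS Ar Rr) Δ B (.pi (Elcon s₁ A) (Ucon s₂))) :
    StableTyped (sigEPTS Ar Rr) (rulesEPTS Ar Rr) Δ (ProdC s₁ s₂ A B) (Ucon s₃) :=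
  fun σ _ hσ => by
    simpa using Typed.prodCode hR (by simpa using hA _ _ hσ) (by simpa using hB _ _ hσ)

theorem absCode {s₁ s₂ s₃ : S} (hR : Rr s₁ s₂ s₃) {A B M : Tm (EConst S)}
    (hA : StableTyped (sigEPTS Ar Rr) (rulesEPTS Ar Rr) Δ A (Ucon s₁))
    (hB : StableTyped (sigEPTS Ar Rr) (rulesEPTS Ar Rr) Δ B (.pi (Elcon s₁ A) (Ucon s₂)))
    (hM : StableTyped (sigEPTS Ar Rr) (rulesEPTS Ar Rr) Δ M
      (.pi (Elcon s₁ A) (Elcon s₂ (.app (B.ren Nat.succ) (.var 0))))) :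
    StableTyped (sigEPTS Ar Rr) (rulesEPTS Ar Rr) Δ (absC s₁ s₂ A B M)
      (Elcon s₃ (ProdC s₁ s₂ A B)) :=
  fun σ _ hσ => by
    simpa using Typed.absCode hR (by simpa using hA _ _ hσ) (by simpa using hB _ _ hσ)
      (by simpa [Tm.sub_liftSub_ren_succ] using hM _ _ hσ)

theorem appCode {s₁ s₂ s₃ : S} (hR : Rr s₁ s₂ s₃) {A B M N : Tm (EConst S)}
    (hA : StableTyped (sigEPTS Ar Rr) (rulesEPTS Ar Rr) Δ A (Ucon s₁))
    (hB : StableTyped (sigEPTS Ar Rr) (rulesEPTS Ar Rr) Δ B (.pi (Elcon s₁ A) (Ucon s₂)))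
    (hM : StableTyped (sigEPTS Ar Rr) (rulesEPTS Ar Rr) Δ M (Elcon s₃ (ProdC s₁ s₂ A B)))
    (hN : StableTyped (sigEPTS Ar Rr) (rulesEPTS Ar Rr) Δ N (Elcon s₁ A)) :
    StableTyped (sigEPTS Ar Rr) (rulesEPTS Ar Rr) Δ (appC s₁ s₂ A B M N)
      (Elcon s₂ (.app B N)) :=
  fun σ _ hσ => by
    simpa using Typed.appCode hR (by simpa using hA _ _ hσ) (by simpa using hB _ _ hσ)
      (by simpa using hM _ _ hσ) (by simpa using hN _ _ hσ)

theorem lam_Ucon {s₁ s₂ : S} {A B : Tm (EConst S)}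
    (hA : StableTyped (sigEPTS Ar Rr) (rulesEPTS Ar Rr) Δ A (Ucon s₁))
    (hB : StableTyped (sigEPTS Ar Rr) (rulesEPTS Ar Rr) (Elcon s₁ A :: Δ) B (Ucon s₂)) :
    StableTyped (sigEPTS Ar Rr) (rulesEPTS Ar Rr) Δ (.lam (Elcon s₁ A) B)
      (.pi (Elcon s₁ A) (Ucon s₂)) :=
  .lam hA.el (.univ s₂) hB

theorem app_Ucon {s₂ : S} {A B N : Tm (EConst S)}
    (hB : StableTyped (sigEPTS Ar Rr) (rulesEPTS Ar Rr) Δ B (.pi A (Ucon s₂)))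
    (hN : StableTyped (sigEPTS Ar Rr) (rulesEPTS Ar Rr) Δ N A) :
    StableTyped (sigEPTS Ar Rr) (rulesEPTS Ar Rr) Δ (.app B N) (Ucon s₂) := by
  simpa [Tm.substAt] using hB.app hN

end StableTyped

namespace Conv
variable {Ar : S → S → Prop} {Rr : S → S → S → Prop}

theorem elcon {R : Rules (EConst S)} {A A' : Tm (EConst S)} (s : S) (h : Conv R A A') :
    Conv R (Elcon s A) (Elcon s A') :=
  .const (.cons h .nil)

theorem elcon_ucon {s₁ s₂ : S} (h : Ar s₁ s₂) :
    Conv (rulesEPTS Ar Rr) (Elcon s₂ (ucon s₁)) (Ucon s₁) :=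
  .rel _ _ (.base (.inr ⟨_, .inl (.u_red h), .var, by simp [Elcon], by simp⟩))

theorem appC_absC {s₁ s₂ s₃ : S} (hR : Rr s₁ s₂ s₃) (A B A' B' M N : Tm (EConst S)) :
    Conv (rulesEPTS Ar Rr) (appC s₁ s₂ A B (absC s₁ s₂ A' B' M) N) (.app M N) :=
  .rel _ _ (.base (.inr ⟨_, .inr (.beta hR), fun n => [A, B, A', B', M, N].getD n (.var n),
    by simp [appC], by simp⟩))

theorem lam_elcon {R : Rules (EConst S)} {A A' M M' : Tm (EConst S)} (s : S)
    (hA : Conv R A A') (hM : Conv R M M') :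
    Conv R (.lam (Elcon s A) M) (.lam (Elcon s A') M') :=
  .lam (hA.elcon s) hM

theorem trans_pi {R : Rules (EConst S)} {s₁ s₂ : S} {A A' B B' : ETm S}
    (hA : Conv R (DKPaper.trans A) (DKPaper.trans A'))
    (hB : Conv R (DKPaper.trans B) (DKPaper.trans B')) :
    Conv R (DKPaper.trans (.pi s₁ s₂ A B)) (DKPaper.trans (.pi s₁ s₂ A' B')) :=
  .const (.cons hA (.cons (hA.lam_elcon s₁ hB) .nil))

theorem trans_lam {R : Rules (EConst S)} {s₁ s₂ : S} {A A' B B' M M' : ETm S}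
    (hA : Conv R (DKPaper.trans A) (DKPaper.trans A'))
    (hB : Conv R (DKPaper.trans B) (DKPaper.trans B'))
    (hM : Conv R (DKPaper.trans M) (DKPaper.trans M')) :
    Conv R (DKPaper.trans (.lam s₁ s₂ A B M)) (DKPaper.trans (.lam s₁ s₂ A' B' M')) :=
  .const (.cons hA (.cons (hA.lam_elcon s₁ hB) (.cons (hA.lam_elcon s₁ hM) .nil)))

theorem trans_app {R : Rules (EConst S)} {s₁ s₂ : S} {A A' B B' M M' N N' : ETm S}
    (hA : Conv R (DKPaper.trans A) (DKPaper.trans A'))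
    (hB : Conv R (DKPaper.trans B) (DKPaper.trans B'))
    (hM : Conv R (DKPaper.trans M) (DKPaper.trans M'))
    (hN : Conv R (DKPaper.trans N) (DKPaper.trans N')) :
    Conv R (DKPaper.trans (.app s₁ s₂ A B M N)) (DKPaper.trans (.app s₁ s₂ A' B' M' N')) :=
  .const (.cons hA (.cons (hA.lam_elcon s₁ hB) (.cons hM (.cons hN .nil))))

end Conv

theorem EStep.conv_trans {Ar : S → S → Prop} {Rr : S → S → S → Prop} {M N : ETm S}
    (h : EStep Rr M N) : Conv (rulesEPTS Ar Rr) (trans M) (trans N) := by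
  unfold EStep at h
  induction h with
  | base h =>
    obtain ⟨s₁, s₂, s₃, A, B, A', B', P, Q, hR, rfl, rfl⟩ := h
    rw [trans_substAt]
    exact (Conv.appC_absC hR _ _ _ _ _ _).trans (.beta _ _ _)
  | piA _ ih => exact .trans_pi ih (.refl _)
  | piB _ ih => exact .trans_pi (.refl _) ih
  | lamA _ ih => exact .trans_lam ih (.refl _) (.refl _)
  | lamB _ ih => exact .trans_lam (.refl _) ih (.refl _)
  | lamM _ ih => exact .trans_lam (.refl _) (.refl _) ih
  | appA _ ih => exact .trans_app ih (.refl _) (.refl _) (.refl _)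
  | appB _ ih => exact .trans_app (.refl _) ih (.refl _) (.refl _)
  | appM _ ih => exact .trans_app (.refl _) (.refl _) ih (.refl _)
  | appN _ ih => exact .trans_app (.refl _) (.refl _) (.refl _) ih

theorem EConv.conv_trans {Ar : S → S → Prop} {Rr : S → S → S → Prop} {M N : ETm S}
    (h : EConv Rr M N) : Conv (rulesEPTS Ar Rr)
      (DKPaper.trans M) (DKPaper.trans N) := by
  induction h with
  | rel _ _ h => exact h.conv_trans
  | refl => exact .refl _
  | symm _ _ _ ih => exact ih.symm
  | trans _ _ _ _ _ ih₁ ih₂ => exact Conv.trans ih₁ ih₂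

/-! ## Soundness -/

theorem TransCtx.getElem? {Ar : S → S → Prop} {Rr : S → S → S → Prop} {Γ : List (ETm S)}
    {Δ : List (Tm (EConst S))} (h : TransCtx Ar Rr Γ Δ) (hΓ : EWf Ar Rr Γ) {n : Nat}
    {A : ETm S} (hA : Γ[n]? = some A) :
    ∃ s, Δ[n]? = some (Elcon s (trans A)) ∧
      ETyped Ar Rr Γ (A.ren (· + (n + 1))) (.sort s) := by
  induction h generalizing n with
  | nil => simp at hA
  | @cons Γ Δ B s _ hB ih =>
    cases n with
    | zero =>
      obtain rfl : B = A := by simpa using hA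
      exact ⟨s, rfl, hB.weaken hΓ⟩
    | succ n =>
      obtain ⟨s', hs', hA'⟩ := ih hB.wf (by simpa using hA)
      refine ⟨s', by simpa using hs', ?_⟩
      simpa [ETm.ren_ren, ETm.ren, add_assoc] using hA'.weaken hΓ

theorem EWf.exists_transCtx {Ar : S → S → Prop} {Rr : S → S → S → Prop} {Γ : List (ETm S)}
    (hΓ : EWf Ar Rr Γ) : ∃ Δ, TransCtx Ar Rr Γ Δ := by
  induction Γ with
  | nil => exact ⟨[], .nil⟩
  | cons A Γ ih =>
    cases hΓ with
    | decl hA =>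
      obtain ⟨Δ, hΔ⟩ := ih hA.wf
      exact ⟨_, .cons hΔ hA⟩

/-- The translation of `Γ ⊢ M : A` holds stably in `Δ`. -/
def TransTyped (Ar : S → S → Prop) (Rr : S → S → S → Prop) (Γ : List (ETm S))
    (Δ : List (Tm (EConst S))) (M A : ETm S) : Prop :=
  (∀ s, A = .sort s → IsTopSort Ar s →
    StableTyped (sigEPTS Ar Rr) (rulesEPTS Ar Rr) Δ (trans M) (Ucon s)) ∧
  (∀ s, ETyped Ar Rr Γ A (.sort s) →
    StableTyped (sigEPTS Ar Rr) (rulesEPTS Ar Rr) Δ (trans M) (Elcon s (trans A)))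

namespace TransTyped
variable {Ar : S → S → Prop} {Rr : S → S → S → Prop} {Γ : List (ETm S)}
  {Δ : List (Tm (EConst S))} {M : ETm S}

theorem of_Ucon {s : S}
    (h : StableTyped (sigEPTS Ar Rr) (rulesEPTS Ar Rr) Δ (trans M) (Ucon s)) :
    TransTyped Ar Rr Γ Δ M (.sort s) := by
  refine ⟨fun s' hs _ => by cases hs; exact h, fun s' hs => ?_⟩
  obtain ⟨s'', hAr, hconv⟩ := hs.sort_inv
  cases hconv.sort_inj
  exact h.conv (StableTyped.univCode hAr).el (Conv.elcon_ucon hAr).symm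

theorem of_Elcon (hfun : FunctionalSpec Ar Rr) {A : ETm S} {s : S}
    (hA : ETyped Ar Rr Γ A (.sort s))
    (h : StableTyped (sigEPTS Ar Rr) (rulesEPTS Ar Rr) Δ (trans M) (Elcon s (trans A))) :
    TransTyped Ar Rr Γ Δ M A := by
  refine ⟨fun s' hs htop => ?_, fun s' hs => hA.unique_sort hfun hs ▸ h⟩
  subst hs
  exact absurd htop hA.not_isTopSort

theorem stableTyped_Ucon {s : S} (hΓ : EWf Ar Rr Γ) (h : TransTyped Ar Rr Γ Δ M (.sort s)) :
    StableTyped (sigEPTS Ar Rr) (rulesEPTS Ar Rr) Δ (trans M) (Ucon s) := by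
  by_cases hs : IsTopSort Ar s
  · exact h.1 s rfl hs
  · obtain ⟨s', hs'⟩ := not_not.mp hs
    exact (h.2 s' (.sort hΓ hs')).conv (.univ s) (Conv.elcon_ucon hs')

end TransTyped

theorem ETyped.transTyped {Ar : S → S → Prop} {Rr : S → S → S → Prop}
    (hfun : FunctionalSpec Ar Rr) {Γ : List (ETm S)} {M A : ETm S} (h : ETyped Ar Rr Γ M A)
    {Δ : List (Tm (EConst S))} (hΔ : TransCtx Ar Rr Γ Δ) : TransTyped Ar Rr Γ Δ M A := by
  induction h using induction_typed generalizing Δ with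
  | sort _ h => exact .of_Ucon (.univCode h)
  | var hΓ h =>
    obtain ⟨s, hs, hA⟩ := hΔ.getElem? hΓ h
    refine .of_Elcon hfun hA ?_
    simpa [trans, trans_ren] using StableTyped.var hs
  | conv hM hB hAB ihM ihB =>
    obtain ⟨s, rfl, htop⟩ | ⟨s, hA⟩ := hM.isTopSort_or_typed
    · exact absurd htop (hB.sort_of_conv hAB).not_isTopSort
    · cases hA.sort_eq_of_conv hfun hB hAB
      exact .of_Elcon hfun hB (((ihM hΔ).2 _ hA).conv
        ((ihB hΔ).stableTyped_Ucon hB.wf).el (hAB.conv_trans.elcon _))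
  | pi hR hA hB ihA ihB =>
    have hA' := (ihA hΔ).stableTyped_Ucon hA.wf
    have hB' := (ihB (.cons hΔ hA)).stableTyped_Ucon hB.wf
    exact .of_Ucon (.prodCode hR hA' (.lam_Ucon hA' hB'))
  | @lam Γ s₁ s₂ s₃ A B M hR hA hB _ ihA ihB ihM =>
    have hA' := (ihA hΔ).stableTyped_Ucon hA.wf
    have hB' := (ihB (.cons hΔ hA)).stableTyped_Ucon hB.wf
    have hfam := StableTyped.lam_Ucon hA' hB'
    refine .of_Elcon hfun (.pi hR hA hB) (.absCode hR hA' hfam ?_)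
    have hvar : StableTyped (sigEPTS Ar Rr) (rulesEPTS Ar Rr) (Elcon s₁ (trans A) :: Δ)
        (.var 0) (Elcon s₁ ((trans A).ren Nat.succ)) := by
      have h : (Elcon s₁ (trans A) :: Δ)[0]? = some (Elcon s₁ (trans A)) := rfl
      simpa using StableTyped.var h
    have hT : StableTyped (sigEPTS Ar Rr) (rulesEPTS Ar Rr) (Elcon s₁ (trans A) :: Δ)
        (Elcon s₂ (.app ((Tm.lam (Elcon s₁ (trans A)) (trans B)).ren Nat.succ) (.var 0)))
        .type :=
      .el (.app_Ucon (A := Elcon s₁ ((trans A).ren Nat.succ))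
        (by simpa using hfam.weaken _) hvar)
    refine .lam hA'.el hT (.conv ((ihM (.cons hΔ hA)).2 _ hB) hT (.elcon _ (.symm ?_)))
    simpa [Tm.substAt_var_zero_ren] using
      Conv.beta (R := rulesEPTS Ar Rr) (Elcon s₁ ((trans A).ren Nat.succ))
        ((trans B).ren (Tm.liftRen Nat.succ)) (.var 0)
  | @app Γ s₁ s₂ s₃ A B M N hR hA hB hN _ ihA ihB ihN ihM =>
    have hA' := (ihA hΔ).stableTyped_Ucon hA.wf
    have hB' := (ihB (.cons hΔ hA)).stableTyped_Ucon hB.wf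
    have hN' := (ihN hΔ).2 _ hA
    have hT : StableTyped (sigEPTS Ar Rr) (rulesEPTS Ar Rr) Δ
        (trans (ETm.substAt 0 N B)) (Ucon s₂) := by
      simpa [Tm.substAt, trans_substAt] using hB'.substAt hN'
    refine .of_Elcon hfun (hB.substAt hN) (.conv (.appCode hR hA' (.lam_Ucon hA' hB')
      ((ihM hΔ).2 _ (.pi hR hA hB)) hN') hT.el (.elcon _ ?_))
    exact trans_substAt .. ▸ .beta _ _ _

theorem TransCtx.wf {Ar : S → S → Prop} {Rr : S → S → S → Prop}
    (hfun : FunctionalSpec Ar Rr) {Γ : List (ETm S)} {Δ : List (Tm (EConst S))}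
    (h : TransCtx Ar Rr Γ Δ) : Wf (sigEPTS Ar Rr) (rulesEPTS Ar Rr) Δ := by
  induction h with
  | nil => exact .empty
  | cons h hA ih =>
    exact .decl (.el (((hA.transTyped hfun h).stableTyped_Ucon hA.wf).typed ih))

/-- Soundness of the encoding. -/
theorem soundness {S : Type} (Ar : S → S → Prop) (Rr : S → S → S → Prop)
    (hfun : FunctionalSpec Ar Rr) :
    (∀ Γ : List (ETm S), EWf Ar Rr Γ →
      ∃ Δ, TransCtx Ar Rr Γ Δ ∧ Wf (sigEPTS Ar Rr) (rulesEPTS Ar Rr) Δ) ∧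
    (∀ (Γ : List (ETm S)) (M A : ETm S), ETyped Ar Rr Γ M A →
      ∀ Δ, TransCtx Ar Rr Γ Δ →
        (∀ s, A = ETm.sort s → IsTopSort Ar s →
          Typed (sigEPTS Ar Rr) (rulesEPTS Ar Rr) Δ (trans M) (Ucon s)) ∧
        (∀ sA, ETyped Ar Rr Γ A (ETm.sort sA) →
          Typed (sigEPTS Ar Rr) (rulesEPTS Ar Rr) Δ (trans M) (Elcon sA (trans A)))) := by
  refine ⟨fun Γ hΓ => ?_, fun Γ M A h Δ hΔ => ?_⟩
  · obtain ⟨Δ, hΔ⟩ := hΓ.exists_transCtx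
    exact ⟨Δ, hΔ, hΔ.wf hfun⟩
  · obtain ⟨htop, htyped⟩ := h.transTyped hfun hΔ
    exact ⟨fun s hs hs' => (htop s hs hs').typed (hΔ.wf hfun),
      fun s hs => (htyped s hs).typed (hΔ.wf hfun)⟩

end DKPaper
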